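/- Let Ω₁ ⊆ ℂ be a generalized Jordan domain such that the union of the singleton connected components of ∂Ω₁ has σ-finite linear measure, and let φ : Ω₁ → Ω₂ be a conformal homeomorphism onto a bounded domain Ω₂ ⊆ ℂ such that the connected components of ∂Ω₂ containing more than one point form a countable family {P_n} with Σ_n diam(P_n) < ∞. Then φ admits a continuous extension φ̄ : closure(Ω₁) → closure(Ω₂) if and only if ∂Ω₂ is a Peano compactum. -/

import Mathlib

open Set Metric Filter MeasureTheory Topology

noncomputable section

/-- A planar domain: a nonempty open connected subset of ℂ. -/
def IsPlanarDomain (D : Set ℂ) : Prop := D.Nonempty ∧ IsOpen D ∧ IsConnected D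

/-- A Peano compactum: a compact subset of ℂ all of whose connected components are
locally connected (as subspaces of ℂ) and such that for every `C > 0` only finitely
many components have diameter greater than `C`. -/
def IsPeanoCompactum (K : Set ℂ) : Prop :=
  IsCompact K ∧
  (∀ x ∈ K, LocallyConnectedSpace ↥(connectedComponentIn K x)) ∧
  ∀ C : ℝ, 0 < C →
    {Q : Set ℂ | (∃ x ∈ K, Q = connectedComponentIn K x) ∧ C < Metric.diam Q}.Finite

/-- A Jordan curve: a subset of ℂ homeomorphic to the unit circle. -/
def IsJordanCurve (J : Set ℂ) : Prop :=
  Nonempty (↥J ≃ₜ ↥(Metric.sphere (0:ℂ) 1))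

/-- A generalized Jordan domain: a bounded domain whose boundary is a Peano compactum,
each of whose boundary components is a single point or a Jordan curve. -/
def IsGeneralizedJordanDomain (D : Set ℂ) : Prop :=
  IsPlanarDomain D ∧ Bornology.IsBounded D ∧
  IsPeanoCompactum (frontier D) ∧
  ∀ x ∈ frontier D,
    connectedComponentIn (frontier D) x = {x} ∨
    IsJordanCurve (connectedComponentIn (frontier D) x)

/-- `φ` restricts to a homeomorphism of `D` onto `Ω`. -/
def IsHomeoOnto (φ : ℂ → ℂ) (D Ω : Set ℂ) : Prop :=
  ContinuousOn φ D ∧ Set.BijOn φ D Ω ∧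
  ∃ ψ : ℂ → ℂ, ContinuousOn ψ Ω ∧ Set.InvOn ψ φ D Ω

/-- `φ` is a conformal homeomorphism (holomorphic bijection) of `D` onto `Ω`. -/
def IsConformalHomeoOnto (φ : ℂ → ℂ) (D Ω : Set ℂ) : Prop :=
  DifferentiableOn ℂ φ D ∧ Set.BijOn φ D Ω

/-- `φb` is a continuous extension of `φ : D → Ω` to `closure D`, with values in `closure Ω`. -/
def ExtendsContinuously (φ φb : ℂ → ℂ) (D Ω : Set ℂ) : Prop :=
  ContinuousOn φb (closure D) ∧ Set.EqOn φb φ D ∧ Set.MapsTo φb (closure D) (closure Ω)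

/-- The oscDiam `σ_r(z₀) = diam φ(D ∩ C_r(z₀))`. -/
def oscDiam (φ : ℂ → ℂ) (D : Set ℂ) (z₀ : ℂ) (r : ℝ) : ℝ :=
  Metric.diam (φ '' (D ∩ Metric.sphere z₀ r))

/-- `liminf_{r→0⁺} σ_r(z₀) = 0`. -/
def OscLiminfZero (φ : ℂ → ℂ) (D : Set ℂ) (z₀ : ℂ) : Prop :=
  Filter.liminf (oscDiam φ D z₀) (nhdsWithin (0:ℝ) (Set.Ioi 0)) = 0

/-- A circle domain (normalized so that ∞ lies in a complementary disk): every bounded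
complementary component is a point or a closed round disk, and the unbounded
complementary component is the complement of an open round disk. -/
def IsCircleDomain (D : Set ℂ) : Prop :=
  IsPlanarDomain D ∧ Bornology.IsBounded D ∧
  ∀ x ∈ Dᶜ,
    (Bornology.IsBounded (connectedComponentIn Dᶜ x) →
      connectedComponentIn Dᶜ x = {x} ∨
      ∃ c : ℂ, ∃ rad : ℝ, 0 < rad ∧ connectedComponentIn Dᶜ x = Metric.closedBall c rad) ∧
    (¬ Bornology.IsBounded (connectedComponentIn Dᶜ x) →
      ∃ c : ℂ, ∃ rad : ℝ, 0 < rad ∧ connectedComponentIn Dᶜ x = (Metric.ball c rad)ᶜ)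

/-- A set has σ-finite linear (1-dimensional Hausdorff) measure. -/
def SigmaFiniteH1 (E : Set ℂ) : Prop :=
  ∃ f : ℕ → Set ℂ, (⋃ n, f n) = E ∧ ∀ n, μH[1] (f n) < ⊤

/-- The set of connected components of `K` containing more than one point. -/
def NondegComponents (K : Set ℂ) : Set (Set ℂ) :=
  {Q | (∃ x ∈ K, Q = connectedComponentIn K x) ∧ ∃ a ∈ Q, ∃ b ∈ Q, a ≠ b}

/-- The union of the singleton connected components of `K`. -/
def SingletonPart (K : Set ℂ) : Set ℂ :=
  {x | x ∈ K ∧ connectedComponentIn K x = {x}}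

/-- The cluster set `C(h, z₀) = ⋂_{r>0} closure h({z ∈ U : |z − z₀| < r})`. -/
def clusterSet (h : ℂ → ℂ) (U : Set ℂ) (z₀ : ℂ) : Set ℂ :=
  ⋂ r ∈ Set.Ioi (0:ℝ), closure (h '' (U ∩ Metric.ball z₀ r))

/-- The boundary component of `Ω` corresponding (under `φ : D → Ω`) to a boundary
component `Q` of `D`: `φ^B(Q) = ⋃_{z ∈ Q} C(φ, z)`. -/
def boundaryComp (φ : ℂ → ℂ) (D : Set ℂ) (Q : Set ℂ) : Set ℂ :=
  ⋃ z ∈ Q, clusterSet φ D z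

/-- An arc: the image of a continuous injective map from `[0,1]`. -/
def IsArc (A : Set ℂ) : Prop :=
  ∃ f : ℝ → ℂ, ContinuousOn f (Set.Icc 0 1) ∧ Set.InjOn f (Set.Icc 0 1) ∧
    f '' Set.Icc 0 1 = A

/-- An arc from `a` to `b`. -/
def IsArcFromTo (A : Set ℂ) (a b : ℂ) : Prop :=
  ∃ f : ℝ → ℂ, ContinuousOn f (Set.Icc 0 1) ∧ Set.InjOn f (Set.Icc 0 1) ∧
    f '' Set.Icc 0 1 = A ∧ f 0 = a ∧ f 1 = b

/-- Property S: for every `ε > 0`, `Ω` is a finite union of connected sets of diameter `< ε`. -/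
def PropertyS (Ω : Set ℂ) : Prop :=
  ∀ ε > (0:ℝ), ∃ (k : ℕ) (N : Fin k → Set ℂ),
    (∀ i, IsConnected (N i) ∧ Metric.diam (N i) < ε) ∧ (⋃ i, N i) = Ω

/-- `x ∈ ∂Ω` is locally accessible from `Ω`. -/
def LocallyAccessible (Ω : Set ℂ) (x : ℂ) : Prop :=
  ∀ ε > (0:ℝ), ∃ δ > (0:ℝ), ∀ z ∈ Ω, dist z x < δ →
    ∃ A : Set ℂ, IsArcFromTo A z x ∧ A ⊆ Ω ∪ {x} ∧ Metric.diam A < ε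

/-- `ξ ∈ ∂Ω` is locally sequentially accessible. -/
def LocallySeqAccessible (Ω : Set ℂ) (ξ : ℂ) : Prop :=
  ∀ r > (0:ℝ), ∀ ξn : ℕ → ℂ, (∀ n, ξn n ∈ Ω) → Filter.Tendsto ξn Filter.atTop (nhds ξ) →
    ∃ x ∈ Ω ∩ Metric.ball ξ r,
      {n : ℕ | ξn n ∈ connectedComponentIn (Ω ∩ Metric.ball ξ r) x}.Infinite

/-- `Ω` is finitely connected at the boundary point `x`. -/
def FinitelyConnectedAt (Ω : Set ℂ) (x : ℂ) : Prop :=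
  ∀ r > (0:ℝ), ∃ U : Set ℂ, IsOpen U ∧ x ∈ U ∧ U ⊆ Metric.ball x r ∧
    {Q : Set ℂ | ∃ y ∈ U ∩ Ω, Q = connectedComponentIn (U ∩ Ω) y}.Finite

/-- The diameter (Mazurkiewicz) distance on `Ω`. -/
def mazDist (Ω : Set ℂ) (x y : ℂ) : ℝ :=
  sInf (Metric.diam '' {E : Set ℂ | E ⊆ Ω ∧ IsConnected E ∧ x ∈ E ∧ y ∈ E})

/-- `Ω` is totally bounded for the Mazurkiewicz distance; for a metric space this is
equivalent to compactness of the metric completion of `(Ω, mazDist)`. -/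
def MazCompletionCompact (Ω : Set ℂ) : Prop :=
  ∀ ε > (0:ℝ), ∃ F : Finset ℂ, ↑F ⊆ Ω ∧ ∀ x ∈ Ω, ∃ y ∈ F, mazDist Ω x y < ε

/-- `f : A → B` is non-alternating: there are no `x, y ∈ B` and no separation of
`A \ f⁻¹({x})` into two disjoint nonempty relatively open sets `A₁, A₂` with
`y ∈ f(A₁) ∩ f(A₂)`. -/
def NonAlternatingOn (f : ℂ → ℂ) (A B : Set ℂ) : Prop :=
  ¬ ∃ x ∈ B, ∃ y ∈ B, ∃ A₁ A₂ : Set ℂ,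
      A₁.Nonempty ∧ A₂.Nonempty ∧ Disjoint A₁ A₂ ∧
      A₁ ∪ A₂ = {z | z ∈ A ∧ f z ≠ x} ∧
      (∃ U₁ : Set ℂ, IsOpen U₁ ∧ A₁ = U₁ ∩ {z | z ∈ A ∧ f z ≠ x}) ∧
      (∃ U₂ : Set ℂ, IsOpen U₂ ∧ A₂ = U₂ ∩ {z | z ∈ A ∧ f z ≠ x}) ∧
      y ∈ f '' A₁ ∧ y ∈ f '' A₂

/-- The function `z ↦ (z - x) / (z - y)` has a continuous logarithm on `X`. -/
def HasLog (X : Set ℂ) (x y : ℂ) : Prop :=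
  ∃ g : ℂ → ℂ, ContinuousOn g X ∧ ∀ z ∈ X, Complex.exp (g z) * (z - y) = z - x

lemma HasLog.mono {X Y : Set ℂ} {x y : ℂ} (h : HasLog Y x y) (hXY : X ⊆ Y) : HasLog X x y := by
  obtain ⟨g, hg, he⟩ := h
  exact ⟨g, hg.mono hXY, fun z hz => he z (hXY hz)⟩

lemma HasLog.symm {X : Set ℂ} {x y : ℂ} (h : HasLog X x y) : HasLog X y x := by
  obtain ⟨g, hg, he⟩ := h
  refine ⟨fun z => -g z, hg.neg, fun z hz => ?_⟩
  rw [← he z hz, ← mul_assoc, ← Complex.exp_add]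
  simp

lemma HasLog.trans {X : Set ℂ} {x y z : ℂ} (h : HasLog X x y) (h' : HasLog X y z) :
    HasLog X x z := by
  obtain ⟨g, hg, he⟩ := h
  obtain ⟨g', hg', he'⟩ := h'
  refine ⟨fun w => g w + g' w, hg.add hg', fun w hw => ?_⟩
  rw [Complex.exp_add, mul_assoc, he' w hw, he w hw]

lemma HasLog.of_infDist {X : Set ℂ} {x y : ℂ} {ε : ℝ}
    (hX : ∀ z ∈ X, ε ≤ dist z x) (hxy : dist y x < ε / 2) : HasLog X x y := by
  have key : ∀ z ∈ X, ‖(z - x) / (z - y) - 1‖ < 1 ∧ z - y ≠ 0 := by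
    intro z hz
    have h1 := hX z hz
    have h2 : dist z x ≤ dist z y + dist y x := dist_triangle _ _ _
    have h3 : dist y x < dist z y := by linarith
    have h4 : 0 < dist z y := lt_of_le_of_lt dist_nonneg h3
    have h5 : z - y ≠ 0 := by
      rw [sub_ne_zero]; exact dist_pos.1 h4
    refine ⟨?_, h5⟩
    rw [div_sub_one h5, norm_div, div_lt_one (norm_pos_iff.2 h5)]
    have : z - x - (z - y) = y - x := by ring
    rw [this, ← dist_eq_norm, ← dist_eq_norm]
    exact h3
  have slit : ∀ z ∈ X, (z - x) / (z - y) ∈ Complex.slitPlane := by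
    intro z hz
    have := (key z hz).1
    left
    have h := (Complex.abs_re_le_norm ((z - x) / (z - y) - 1)).trans_lt this
    rw [Complex.sub_re, Complex.one_re, abs_lt] at h
    linarith
  refine ⟨fun z => Complex.log ((z - x) / (z - y)), ?_, ?_⟩
  · refine ContinuousOn.clog ?_ slit
    exact ContinuousOn.div (by fun_prop) (by fun_prop) fun z hz => (key z hz).2
  · intro z hz
    rw [Complex.exp_log (Complex.slitPlane_ne_zero (slit z hz)), div_mul_cancel₀ _ (key z hz).2]

lemma HasLog.of_isPreconnected {X S : Set ℂ} (hX : IsClosed X) (hS : IsPreconnected S)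
    (hd : Disjoint S X) {x y : ℂ} (hx : x ∈ S) (hy : y ∈ S) : HasLog X x y := by
  refine hS.induction₂ (fun x y => HasLog X x y) ?_ (fun _ _ _ _ _ _ h h' => h.trans h')
    (fun _ _ _ _ h => h.symm) hx hy
  intro a ha
  have haX : a ∉ X := disjoint_left.1 hd ha
  obtain ⟨ε, hε, hb⟩ := Metric.isOpen_iff.1 hX.isOpen_compl a haX
  filter_upwards [mem_nhdsWithin_of_mem_nhds (ball_mem_nhds a (half_pos hε))] with b hb'
  refine HasLog.of_infDist (fun z hz => ?_) hb'
  by_contra hlt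
  exact hb (mem_ball.2 (not_le.1 hlt)) hz

lemma IsPreconnected.exists_int_const {S : Set ℂ} (hS : IsPreconnected S) {f : ℂ → ℂ}
    (hf : ContinuousOn f S) (h1 : ∀ z ∈ S, Complex.exp (f z) = 1) :
    ∃ c : ℂ, Complex.exp c = 1 ∧ ∀ z ∈ S, f z = c := by
  rcases S.eq_empty_or_nonempty with rfl | ⟨z₀, hz₀⟩
  · exact ⟨0, by simp, by simp⟩
  refine ⟨f z₀, h1 z₀ hz₀, fun z hz => ?_⟩
  refine hS.induction₂ (fun x y => f y = f x) ?_ (fun _ _ _ _ _ _ h h' => h'.trans h)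
    (fun _ _ _ _ h => h.symm) hz₀ hz
  intro a ha
  have := (hf a ha) (ball_mem_nhds (f a) (show (0:ℝ) < 1 by norm_num))
  filter_upwards [this, self_mem_nhdsWithin] with b hb hbS
  have hb' : ‖f b - f a‖ < 1 := by rwa [← dist_eq_norm]
  have he : Complex.exp (f b - f a) = 1 := by
    rw [Complex.exp_sub, h1 b hbS, h1 a ha, div_one]
  obtain ⟨n, hn⟩ := Complex.exp_eq_one_iff.1 he
  have hn0 : n = 0 := by
    by_contra h0
    rw [hn] at hb'
    have : (1:ℝ) ≤ ‖(n : ℂ)‖ := by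
      rw [Complex.norm_intCast]
      exact_mod_cast Int.one_le_abs h0
    rw [norm_mul] at hb'
    have h2 : (1:ℝ) ≤ ‖(2 * (Real.pi:ℂ) * Complex.I)‖ := by
      simp only [norm_mul, Complex.norm_ofNat, Complex.norm_real, Complex.norm_I, mul_one,
        Real.norm_eq_abs, abs_of_pos Real.pi_pos]
      linarith [Real.pi_gt_three]
    nlinarith
  rw [hn0] at hn
  simpa [sub_eq_zero] using hn

lemma HasLog.union {X Y : Set ℂ} {x y : ℂ} (hX : IsClosed X) (hY : IsClosed Y)
    (hXY : IsPreconnected (X ∩ Y)) (hx : x ∉ X ∩ Y) 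
    (h : HasLog X x y) (h' : HasLog Y x y) : HasLog (X ∪ Y) x y := by
  classical
  obtain ⟨g, hg, he⟩ := h
  obtain ⟨g', hg', he'⟩ := h'
  obtain ⟨c, hc1, hc⟩ := hXY.exists_int_const (f := fun z => g z - g' z)
    ((hg.mono inter_subset_left).sub (hg'.mono inter_subset_right)) (by
      intro z hz
      have h0 : z - x ≠ 0 := sub_ne_zero.2 (fun h => hx (h ▸ hz))
      have e1 := he z hz.1
      have e2 := he' z hz.2
      have h1 : z - y ≠ 0 := by
        intro h1; rw [h1, mul_zero] at e1; exact h0 e1.symm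
      rw [Complex.exp_sub, div_eq_one_iff_eq (Complex.exp_ne_zero _)]
      exact mul_right_cancel₀ h1 (e1.trans e2.symm))
  set G : ℂ → ℂ := fun z => if z ∈ X then g z else g' z + c with hG
  have hGX : EqOn G g X := fun z hz => by simp [hG, hz]
  have hGY : EqOn G (fun z => g' z + c) Y := fun z hz => by
    by_cases hzX : z ∈ X
    · have := hc z ⟨hzX, hz⟩
      simp only [hG, hzX, if_true]
      rw [← this]; ring
    · simp [hG, hzX]
  refine ⟨G, ContinuousOn.union_of_isClosed (hg.congr hGX)
    ((hg'.add continuousOn_const).congr hGY) hX hY, ?_⟩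
  rintro z (hz | hz)
  · rw [hGX hz, he z hz]
  · rw [hGY hz, Complex.exp_add, hc1, mul_one, he' z hz]

lemma exists_log_closedBall {M : ℂ → ℂ} (hM : Continuous M) (h0 : ∀ z, M z ≠ 0) (ρ : ℝ) :
    ∃ L : ℂ → ℂ, ContinuousOn L (closedBall 0 ρ) ∧
      ∀ z ∈ closedBall (0:ℂ) ρ, Complex.exp (L z) = M z := by
  have hK : IsCompact (closedBall (0:ℂ) ρ) := isCompact_closedBall 0 ρ
  have huc : UniformContinuousOn M (closedBall 0 ρ) :=
    hK.uniformContinuousOn_of_continuous hM.continuousOn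
  obtain ⟨m, hm, hmM⟩ : ∃ m > 0, ∀ z ∈ closedBall (0:ℂ) ρ, m ≤ ‖M z‖ := by
    rcases (closedBall (0:ℂ) ρ).eq_empty_or_nonempty with h | h
    · exact ⟨1, one_pos, by simp [h]⟩
    obtain ⟨z, hz, hmin⟩ := hK.exists_isMinOn h hM.norm.continuousOn
    exact ⟨‖M z‖, norm_pos_iff.2 (h0 z), fun w hw => hmin hw⟩
  obtain ⟨δ, hδ, hδM⟩ := Metric.uniformContinuousOn_iff.1 huc m hm
  obtain ⟨n, hn⟩ := exists_nat_gt (max 0 ρ / δ)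
  have hn0 : (0:ℝ) < n := lt_of_le_of_lt (by positivity) hn
  set p : ℕ → ℂ → ℂ := fun k z => ((k / n : ℝ) : ℂ) * z with hp
  have hpn : ∀ z, p n z = z := fun z => by
    simp only [hp, div_self hn0.ne', Complex.ofReal_one, one_mul]
  have hpball : ∀ k ≤ n, ∀ z ∈ closedBall (0:ℂ) ρ, p k z ∈ closedBall (0:ℂ) ρ := by
    intro k hk z hz
    rw [mem_closedBall_zero_iff] at hz ⊢
    have : (k / n : ℝ) ≤ 1 := by
      rw [div_le_one hn0]; exact_mod_cast hk
    simp only [hp, norm_mul, Complex.norm_real, Real.norm_eq_abs]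
    rw [abs_of_nonneg (by positivity)]
    nlinarith [norm_nonneg z]
  have hclose : ∀ k < n, ∀ z ∈ closedBall (0:ℂ) ρ, M (p (k+1) z) / M (p k z) ∈ Complex.slitPlane := by
    intro k hk z hz
    have hd : dist (p (k+1) z) (p k z) < δ := by
      have : p (k+1) z - p k z = ((1 / n : ℝ):ℂ) * z := by
        simp only [hp]; push_cast; field_simp; ring
      rw [dist_eq_norm, this, norm_mul, Complex.norm_real, Real.norm_eq_abs, 
        abs_of_pos (by positivity)]
      rw [mem_closedBall_zero_iff] at hz
      rw [div_lt_iff₀ hδ] at hn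
      have : ‖z‖ < n * δ := lt_of_le_of_lt (hz.trans (le_max_right _ _)) hn
      rw [div_mul_eq_mul_div, one_mul, div_lt_iff₀ hn0, mul_comm]; exact this
    have h1 := hδM _ (hpball (k+1) hk z hz) _ (hpball k hk.le z hz) hd
    have h2 := hmM _ (hpball k hk.le z hz)
    left
    have h3 : ‖M (p (k+1) z) / M (p k z) - 1‖ < 1 := by
      rw [div_sub_one (h0 _), norm_div, div_lt_one (norm_pos_iff.2 (h0 _)), ← dist_eq_norm]
      linarith
    have h := (Complex.abs_re_le_norm _).trans_lt h3
    rw [Complex.sub_re, Complex.one_re, abs_lt] at h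
    linarith
  refine ⟨fun z => Complex.log (M 0) +
    ∑ k ∈ Finset.range n, Complex.log (M (p (k+1) z) / M (p k z)), ?_, ?_⟩
  · refine continuousOn_const.add (continuousOn_finsetSum _ fun k hk => ?_)
    refine ContinuousOn.clog ?_ (hclose k (Finset.mem_range.1 hk))
    have hc : ∀ k, Continuous (p k) := fun k => by simp only [hp]; fun_prop
    exact ((hM.comp (hc _)).div (hM.comp (hc _)) fun z => h0 _).continuousOn
  · intro z hz
    have : ∀ j ≤ n, Complex.exp (Complex.log (M 0) +
        ∑ k ∈ Finset.range j, Complex.log (M (p (k+1) z) / M (p k z))) = M (p j z) := by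
      intro j
      induction j with
      | zero => intro _; simp [hp, Complex.exp_log (h0 0)]
      | succ j ih =>
        intro hj
        rw [Finset.sum_range_succ, ← add_assoc, Complex.exp_add, ih (by omega),
          Complex.exp_log (Complex.slitPlane_ne_zero (hclose j (by omega) z hz)),
          mul_div_cancel₀ _ (h0 _)]
    rw [this n le_rfl, hpn]

lemma not_exists_log_eventually_sub {M : ℂ → ℂ} (hM : Continuous M) (h0 : ∀ z, M z ≠ 0) (x : ℂ)
    {ρ : ℝ} (hρ : 0 < ρ) (hMx : ∀ z, dist z x = ρ → M z = z - x) : False := by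
  obtain ⟨L, hL, hLM⟩ := exists_log_closedBall hM h0 (‖x‖ + ρ)
  set c : ℝ → ℂ := fun θ => x + ρ * Complex.exp (θ * Complex.I) with hc
  have hcb : ∀ θ, c θ ∈ closedBall (0:ℂ) (‖x‖ + ρ) := by
    intro θ
    rw [mem_closedBall_zero_iff]
    refine (norm_add_le _ _).trans ?_
    simp [Complex.norm_exp_ofReal_mul_I, abs_of_pos hρ]
  have hcd : ∀ θ, dist (c θ) x = ρ := by
    intro θ
    simp [hc, dist_eq_norm, Complex.norm_exp_ofReal_mul_I, abs_of_pos hρ]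
  have hcc : Continuous c := by simp only [hc]; fun_prop
  set f : ℂ → ℂ := fun z => L (c z.re) - z.re * Complex.I - Real.log ρ with hf
  have hfc : Continuous f := by
    have : Continuous fun z : ℂ => L (c z.re) :=
      hL.comp_continuous (hcc.comp Complex.continuous_re) (fun z => hcb _)
    exact (this.sub (by fun_prop)).sub continuous_const
  have hρ' : (ρ:ℂ) ≠ 0 := by exact_mod_cast hρ.ne'
  obtain ⟨k, -, hk⟩ := isPreconnected_univ.exists_int_const hfc.continuousOn (by
    intro z _
    simp only [hf]
    rw [Complex.exp_sub, Complex.exp_sub, hLM _ (hcb _), hMx _ (hcd _), Complex.ofReal_log hρ.le,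
      Complex.exp_log hρ']
    simp only [hc, add_sub_cancel_left]
    field_simp [Complex.exp_ne_zero])
  have h1 := hk 0 (mem_univ _)
  have h2 := hk ((2 * Real.pi : ℝ) : ℂ) (mem_univ _)
  have hcc' : c (2 * Real.pi) = c 0 := by
    simp [hc, Complex.exp_two_pi_mul_I]
  rw [← h1] at h2
  simp only [hf, Complex.ofReal_re, hcc', Complex.zero_re] at h2
  have := sub_left_inj.1 h2
  simp [Real.pi_ne_zero] at this

lemma not_hasLog_of_frontier_subset {X O : Set ℂ} {x y : ℂ} (hO : IsOpen O)
    (hb : Bornology.IsBounded O) (hx : x ∈ O) (hyO : y ∉ O) (hyX : y ∉ X)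
    (hfr : frontier O ⊆ X) : ¬ HasLog X x y := by
  classical
  intro h
  obtain ⟨g, hg, he⟩ := h.mono hfr
  obtain ⟨G, hG⟩ := ContinuousMap.exists_restrict_eq (isClosed_frontier (s := O))
    ⟨(frontier O).domRestrict g, hg.domRestrict⟩
  have hGg : ∀ z ∈ frontier O, G z = g z := by
    intro z hz
    exact congrArg (fun F : C(frontier O, ℂ) => F ⟨z, hz⟩) hG
  have hyc : y ∉ closure O := by
    intro hy
    exact hyX (hfr ⟨hy, by rwa [hO.interior_eq]⟩)
  set M : ℂ → ℂ := fun z => if z ∈ O then Complex.exp (G z) * (z - y) else z - x with hM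
  have hMc : Continuous M := by
    refine Continuous.if (p := fun z => z ∈ O) (fun z hz => ?_) (by fun_prop) (by fun_prop)
    have hz' : z ∈ frontier O := hz
    rw [hGg z hz', he z hz']
  have hM0 : ∀ z, M z ≠ 0 := by
    intro z
    by_cases hz : z ∈ O
    · simp only [hM, hz, if_true]
      exact mul_ne_zero (Complex.exp_ne_zero _) (sub_ne_zero.2 fun h => hyO (h ▸ hz))
    · simp only [hM, hz, if_false]
      exact sub_ne_zero.2 fun h => hz (h ▸ hx)
  obtain ⟨r, hr⟩ := hb.subset_ball x
  refine not_exists_log_eventually_sub hMc hM0 x (ρ := max r 1) (by positivity) fun z hz => ?_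
  have : z ∉ O := fun h => by
    have := hr h
    rw [mem_ball, hz] at this
    exact absurd (le_max_left r 1) (not_le.2 this)
  simp [hM, this]

lemma IsCompact.exists_isOpen_superset_connectedComponentIn {K : Set ℂ} (hK : IsCompact K) {z : ℂ}
    (hz : z ∈ K) {N : Set ℂ} (hN : IsOpen N) (hHN : connectedComponentIn K z ⊆ N) :
    ∃ M, IsOpen M ∧ connectedComponentIn K z ⊆ M ∧ IsClosed (K ∩ M) ∧
      ∀ s ∈ K ∩ M, connectedComponentIn K s ⊆ N := by
  have : CompactSpace K := isCompact_iff_compactSpace.1 hK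
  have hC := connectedComponent_eq_iInter_isClopen (⟨z, hz⟩ : K)
  rw [connectedComponentIn_eq_image hz] at hHN ⊢
  have : Nonempty { s : Set K // IsClopen s ∧ (⟨z, hz⟩ : K) ∈ s } :=
    ⟨⟨univ, isClopen_univ, mem_univ _⟩⟩
  obtain ⟨⟨F, hF, hzF⟩, hFN⟩ := exists_subset_nhds_of_compactSpace
    (V := fun s : { s : Set K // IsClopen s ∧ (⟨z, hz⟩ : K) ∈ s } => (s : Set K))
    (fun s t => ⟨⟨s.1 ∩ t.1, s.2.1.inter t.2.1, s.2.2, t.2.2⟩, inter_subset_left,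
      inter_subset_right⟩) (fun s => s.2.1.isClosed) (U := Subtype.val ⁻¹' N) (by
      intro x hx
      rw [← hC] at hx
      exact (hN.preimage continuous_subtype_val).mem_nhds (hHN ⟨x, hx, rfl⟩))
  obtain ⟨M, hM, hMF⟩ := isOpen_induced_iff.1 hF.isOpen
  have hKM : K ∩ M = Subtype.val '' F := by
    rw [← hMF, Subtype.image_preimage_coe]
  refine ⟨M, hM, ?_, ?_, ?_⟩
  · rintro _ ⟨x, hx, rfl⟩
    have : x ∈ F := hF.connectedComponent_subset hzF hx
    rw [← hMF] at this
    exact this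
  · rw [hKM]
    exact (hF.isClosed.isCompact.image continuous_subtype_val).isClosed
  · intro s hs
    rw [connectedComponentIn_eq_image hs.1]
    rintro _ ⟨x, hx, rfl⟩
    have hsF : (⟨s, hs.1⟩ : K) ∈ F := by rw [← hMF]; exact hs.2
    exact hFN (hF.connectedComponent_subset hsF hx)

lemma frontier_connectedComponentIn_subset_compl {W : Set ℂ} (hW : IsOpen W) (x : ℂ) :
    frontier (connectedComponentIn W x) ⊆ Wᶜ := by
  intro w hw hwW
  have : connectedComponentIn W w ∈ 𝓝 w :=
      hW.connectedComponentIn.mem_nhds (mem_connectedComponentIn hwW)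
  obtain ⟨v, hv, hv'⟩ := mem_closure_iff_nhds.1 hw.1 _ this
  have e1 := connectedComponentIn_eq hv
  have e2 := connectedComponentIn_eq hv'
  apply hw.2
  rw [hW.connectedComponentIn.interior_eq, e2, ← e1]
  exact mem_connectedComponentIn hwW

lemma isPreconnected_inter_of_component {U F N : Set ℂ} (hU : IsPreconnected U)
    (hUo : IsOpen U) (hUb : Bornology.IsBounded U) (hF : IsClosed F) (hFU : Disjoint F U)
    (hN : IsOpen N) (hFN : F ⊆ N) (hNF : N \ U ⊆ F) (z : ℂ) :
    IsPreconnected (U ∩ connectedComponentIn N z) := by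
  set C := connectedComponentIn N z with hC
  have hCo : IsOpen C := hN.connectedComponentIn
  have hCN : C ⊆ N := connectedComponentIn_subset N z
  have hFC : IsClosed (F ∩ C) := by
    rw [← isOpen_compl_iff, isOpen_iff_mem_nhds]
    intro w hw
    by_cases hwF : w ∈ F
    · have hwC : w ∉ C := fun h => hw ⟨hwF, h⟩
      have hwN := hFN hwF
      have : connectedComponentIn N w ∈ 𝓝 w :=
        hN.connectedComponentIn.mem_nhds (mem_connectedComponentIn hwN)
      filter_upwards [this] with v hv hv'
      apply hwC
      have e1 := connectedComponentIn_eq hv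
      have e2 := connectedComponentIn_eq hv'.2
      rw [hC, e2, ← e1]
      exact mem_connectedComponentIn hwN
    · filter_upwards [hF.isOpen_compl.mem_nhds hwF] with v hv hv'
      exact hv hv'.1
  refine isPreconnected_of_forall_pair fun x hx y hy => ?_
  have hl1 : HasLog (F ∩ C) x y := HasLog.of_isPreconnected hFC hU
    (hFU.symm.mono_right inter_subset_left) hx.1 hy.1
  have hl2 : HasLog Cᶜ x y := HasLog.of_isPreconnected hCo.isClosed_compl
    isPreconnected_connectedComponentIn disjoint_compl_right hx.2 hy.2
  have he : F ∩ C ∩ Cᶜ = ∅ := by ext; simp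
  have hl := hl1.union hFC hCo.isClosed_compl (by rw [he]; exact isPreconnected_empty)
    (by rw [he]; exact notMem_empty _) hl2
  have hcompl : (F ∩ C ∪ Cᶜ) = (U ∩ C)ᶜ := by
    ext w
    simp only [mem_union, mem_inter_iff, mem_compl_iff]
    constructor
    · rintro (h | h) h'
      · exact disjoint_left.1 hFU h.1 h'.1
      · exact h h'.2
    · intro h
      by_cases hwC : w ∈ C
      · left; exact ⟨hNF ⟨hCN hwC, fun hu => h ⟨hu, hwC⟩⟩, hwC⟩
      · right; exact hwC
  rw [hcompl] at hl
  have hUCo : IsOpen (U ∩ C) := hUo.inter hCo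
  have hyO : y ∈ connectedComponentIn (U ∩ C) x := by
    by_contra hyO
    refine not_hasLog_of_frontier_subset (O := connectedComponentIn (U ∩ C) x)
      hUCo.connectedComponentIn
      (hUb.subset ((connectedComponentIn_subset _ _).trans inter_subset_left))
      (mem_connectedComponentIn hx) hyO (notMem_compl_iff.2 hy)
      (frontier_connectedComponentIn_subset_compl hUCo x) hl
  exact ⟨_, connectedComponentIn_subset _ _, mem_connectedComponentIn hx, hyO,
    isPreconnected_connectedComponentIn⟩

lemma exists_isOpen_isPreconnected_inter {U : Set ℂ} {R : ℝ} (hU : IsPreconnected U)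
    (hUo : IsOpen U) (hUR : U ⊆ ball 0 R) {z : ℂ} (hz : z ∈ closedBall 0 R \ U)
    {N : Set ℂ} (hN : IsOpen N) (hHN : connectedComponentIn (closedBall 0 R \ U) z ⊆ N) :
    ∃ N', IsOpen N' ∧ connectedComponentIn (closedBall 0 R \ U) z ⊆ N' ∧
      IsPreconnected (U ∩ N') ∧ U ∩ N' ⊆ N := by
  set K := closedBall (0:ℂ) R \ U with hKdef
  set H := connectedComponentIn K z with hH
  have hK : IsCompact K := (isCompact_closedBall 0 R).diff hUo
  have hUb : Bornology.IsBounded U := isBounded_ball.subset hUR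
  have hHpre : IsPreconnected H := isPreconnected_connectedComponentIn
  have hzH : z ∈ H := mem_connectedComponentIn hz
  by_cases hS : (sphere (0:ℂ) R ∩ H).Nonempty
  · have hSK : sphere (0:ℂ) R ⊆ K := fun w hw => ⟨sphere_subset_closedBall hw, fun h => by
      have h1 := mem_ball.1 (hUR h)
      rw [mem_sphere.1 hw] at h1; exact lt_irrefl _ h1⟩
    have hSpre : IsPreconnected (sphere (0:ℂ) R) :=
      isPreconnected_sphere (by rw [Complex.rank_real_complex]; norm_num) 0 R
    have hSH : sphere (0:ℂ) R ⊆ H := by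
      obtain ⟨s, hs, hsH⟩ := hS
      have := hSpre.subset_connectedComponentIn hs hSK
      rwa [hH, connectedComponentIn_eq hsH]
    obtain ⟨M, hM, hHM, hKM, hMN⟩ := hK.exists_isOpen_superset_connectedComponentIn hz hN hHN
    set F := (K ∩ M) ∪ (ball (0:ℂ) R)ᶜ with hF
    set N1 := (N ∩ M) ∪ (closedBall (0:ℂ) R)ᶜ with hN1
    have hKMN : K ∩ M ⊆ N := fun w hw => hMN w hw (mem_connectedComponentIn hw.1)
    have hN1o : IsOpen N1 := (hN.inter hM).union isClosed_closedBall.isOpen_compl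
    refine ⟨connectedComponentIn N1 z, hN1o.connectedComponentIn,
      hHpre.subset_connectedComponentIn hzH fun w hw => Or.inl ⟨hHN hw, hHM hw⟩,
      isPreconnected_inter_of_component hU hUo hUb (F := F) (hKM.union isOpen_ball.isClosed_compl)
        ?_ hN1o ?_ ?_ z, ?_⟩
    · rw [disjoint_left]
      rintro w (hw | hw) hwU
      · exact hw.1.2 hwU
      · exact hw (hUR hwU)
    · rintro w (hw | hw)
      · exact Or.inl ⟨hKMN hw, hw.2⟩
      · by_cases hw' : w ∈ closedBall (0:ℂ) R
        · have hwS : w ∈ H := hSH (by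
            rw [mem_sphere]; rw [mem_closedBall] at hw'
            exact le_antisymm hw' (not_lt.1 hw))
          exact Or.inl ⟨hHN hwS, hHM hwS⟩
        · exact Or.inr hw'
    · rintro w ⟨hw | hw, hwU⟩
      · by_cases hw' : w ∈ closedBall (0:ℂ) R
        · exact Or.inl ⟨⟨hw', hwU⟩, hw.2⟩
        · exact Or.inr fun h => hw' (ball_subset_closedBall h)
      · exact Or.inr fun h => hw (ball_subset_closedBall h)
    · rintro w ⟨hwU, hw⟩
      rcases connectedComponentIn_subset _ _ hw with h | h
      · exact h.1
      · exact absurd (ball_subset_closedBall (hUR hwU)) h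
  · have hHb : H ⊆ ball 0 R := by
      intro w hw
      by_contra hwb
      have hwK := connectedComponentIn_subset _ _ hw
      refine hS ⟨w, ?_, hw⟩
      rw [mem_sphere]
      exact le_antisymm (mem_closedBall.1 hwK.1) (not_lt.1 hwb)
    have hNb : IsOpen (N ∩ ball 0 R) := hN.inter isOpen_ball
    obtain ⟨M, hM, hHM, hKM, hMN⟩ := hK.exists_isOpen_superset_connectedComponentIn hz hNb
      (subset_inter hHN hHb)
    set F := K ∩ M with hF
    set N1 := N ∩ ball (0:ℂ) R ∩ M with hN1
    have hKMN : K ∩ M ⊆ N ∩ ball 0 R := fun w hw => hMN w hw (mem_connectedComponentIn hw.1)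
    have hN1o : IsOpen N1 := hNb.inter hM
    refine ⟨connectedComponentIn N1 z, hN1o.connectedComponentIn,
      hHpre.subset_connectedComponentIn hzH fun w hw => ⟨⟨hHN hw, hHb hw⟩, hHM hw⟩,
      isPreconnected_inter_of_component hU hUo hUb (F := F) hKM
        ?_ hN1o (fun w hw => ⟨hKMN hw, hw.2⟩) ?_ z, ?_⟩
    · rw [disjoint_left]
      intro w hw hwU
      exact hw.1.2 hwU
    · rintro w ⟨hw, hwU⟩
      exact ⟨⟨ball_subset_closedBall hw.1.2, hwU⟩, hw.2⟩
    · rintro w ⟨hwU, hw⟩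
      exact (connectedComponentIn_subset _ _ hw).1.1

/-- Mutually inverse homeomorphisms `φ : U → V`, `ψ : V → U` between connected open subsets of the
disk of radius `R`. -/
structure HomeoPair (U V : Set ℂ) (R : ℝ) (φ ψ : ℂ → ℂ) : Prop where
  openU : IsOpen U
  openV : IsOpen V
  preU : IsPreconnected U
  preV : IsPreconnected V
  subU : U ⊆ ball 0 R
  subV : V ⊆ ball 0 R
  contφ : ContinuousOn φ U
  contψ : ContinuousOn ψ V
  mapsφ : MapsTo φ U V
  mapsψ : MapsTo ψ V U
  left : ∀ z ∈ U, ψ (φ z) = z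
  right : ∀ w ∈ V, φ (ψ w) = w

/-- The boundary points `x` of `U` and `w` correspond to each other under `φ`: `w` is a limit of
`φ` at `x`. -/
def BdryRel (φ : ℂ → ℂ) (U : Set ℂ) (x w : ℂ) : Prop :=
  x ∉ U ∧ (x, w) ∈ closure ((fun z => (z, φ z)) '' U)

/-- The subset of `closure V` corresponding under `φ : U → V` to a subset `τ` of the plane. -/
def transfer (φ : ℂ → ℂ) (U V τ : Set ℂ) : Set ℂ :=
  {w | (∃ s ∈ τ ∩ U, φ s = w) ∨
    ∃ s ∈ τ, ∃ w', BdryRel φ U s w' ∧ w ∈ connectedComponentIn (frontier V) w'}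

lemma BdryRel.exists_seq {φ : ℂ → ℂ} {U : Set ℂ} {x w : ℂ} (h : BdryRel φ U x w) :
    ∃ z : ℕ → ℂ, (∀ n, z n ∈ U) ∧ Tendsto z atTop (𝓝 x) ∧
      Tendsto (fun n => φ (z n)) atTop (𝓝 w) := by
  obtain ⟨p, hp, hlim⟩ := mem_closure_iff_seq_limit.1 h.2
  choose z hz hzp using hp
  refine ⟨z, hz, ?_, ?_⟩
  · convert (continuous_fst.tendsto _).comp hlim using 1
    ext n; simp [← hzp n]
  · convert (continuous_snd.tendsto _).comp hlim using 1
    ext n; simp [← hzp n]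

lemma BdryRel.of_seq {φ : ℂ → ℂ} {U : Set ℂ} {x w : ℂ} (hx : x ∉ U) {z : ℕ → ℂ}
    (hz : ∀ n, z n ∈ U) (hzx : Tendsto z atTop (𝓝 x))
    (hzw : Tendsto (fun n => φ (z n)) atTop (𝓝 w)) : BdryRel φ U x w :=
  ⟨hx, mem_closure_of_tendsto (hzx.prodMk_nhds hzw) (Eventually.of_forall fun n => ⟨z n, hz n, rfl⟩)⟩

lemma BdryRel.mem_frontier {φ : ℂ → ℂ} {U : Set ℂ} {x w : ℂ} (h : BdryRel φ U x w)
    (hU : IsOpen U) : x ∈ frontier U := by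
  obtain ⟨z, hz, hzx, -⟩ := h.exists_seq
  rw [hU.frontier_eq]
  exact ⟨mem_closure_of_tendsto hzx (Eventually.of_forall hz), h.1⟩

lemma isClosed_connectedComponentIn {X : Type*} [TopologicalSpace X] {F : Set X}
    (hF : IsClosed F) (x : X) : IsClosed (connectedComponentIn F x) := by
  by_cases hx : x ∈ F
  · have h := (isPreconnected_connectedComponentIn (x := x) (F := F)).closure
    have := h.subset_connectedComponentIn (subset_closure (mem_connectedComponentIn hx))
      (closure_minimal (connectedComponentIn_subset F x) hF)
    exact isClosed_of_closure_subset this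
  · rw [connectedComponentIn_eq_empty hx]
    exact isClosed_empty

namespace HomeoPair

variable {U V : Set ℂ} {R : ℝ} {φ ψ : ℂ → ℂ}

lemma symm (h : HomeoPair U V R φ ψ) : HomeoPair V U R ψ φ :=
  ⟨h.openV, h.openU, h.preV, h.preU, h.subV, h.subU, h.contψ, h.contφ, h.mapsψ, h.mapsφ,
    h.right, h.left⟩

lemma rel_symm (h : HomeoPair U V R φ ψ) {x w : ℂ} (hr : BdryRel φ U x w) :
    BdryRel ψ V w x := by
  obtain ⟨z, hz, hzx, hzw⟩ := hr.exists_seq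
  have hzx' : Tendsto (fun n => ψ (φ (z n))) atTop (𝓝 x) := by
    simpa only [h.left _ (hz _)] using hzx
  refine BdryRel.of_seq (fun hw => ?_) (fun n => h.mapsφ (hz n)) hzw hzx'
  have hc : ContinuousAt ψ w := h.contψ.continuousAt (h.openV.mem_nhds hw)
  have := tendsto_nhds_unique hzx' (hc.tendsto.comp hzw)
  exact hr.1 (this ▸ h.mapsψ hw)

lemma exists_rel (h : HomeoPair U V R φ ψ) {x : ℂ} (hx : x ∈ frontier U) :
    ∃ w, BdryRel φ U x w := by
  rw [h.openU.frontier_eq] at hx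
  obtain ⟨z, hz, hzx⟩ := mem_closure_iff_seq_limit.1 hx.1
  obtain ⟨w, -, σ, hσ, hw⟩ := (isCompact_closedBall (0:ℂ) R).tendsto_subseq
    (x := fun n => φ (z n)) fun n => ball_subset_closedBall (h.subV (h.mapsφ (hz n)))
  exact ⟨w, BdryRel.of_seq hx.2 (z := z ∘ σ) (fun n => hz _) (hzx.comp hσ.tendsto_atTop) hw⟩

lemma exists_rel' (h : HomeoPair U V R φ ψ) {w : ℂ} (hw : w ∈ frontier V) :
    ∃ x, BdryRel φ U x w := by
  obtain ⟨x, hx⟩ := h.symm.exists_rel hw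
  exact ⟨x, h.symm.rel_symm hx⟩

lemma isCompact_closure_graph (h : HomeoPair U V R φ ψ) :
    IsCompact (closure ((fun z => (z, φ z)) '' U)) := by
  refine ((isCompact_closedBall (0:ℂ) R).prod (isCompact_closedBall (0:ℂ) R)).of_isClosed_subset
    isClosed_closure (closure_minimal ?_ (isClosed_closedBall.prod isClosed_closedBall))
  rintro _ ⟨z, hz, rfl⟩
  exact ⟨ball_subset_closedBall (h.subU hz), ball_subset_closedBall (h.subV (h.mapsφ hz))⟩

lemma frontier_subset (h : HomeoPair U V R φ ψ) : frontier U ⊆ closedBall 0 R \ U := by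
  rw [h.openU.frontier_eq]
  exact sdiff_subset_sdiff_left
    ((closure_mono h.subU).trans closure_ball_subset_closedBall)

lemma isCompact_frontier (h : HomeoPair U V R φ ψ) : IsCompact (frontier U) :=
  ((isCompact_closedBall (0:ℂ) R).diff h.openU).of_isClosed_subset isClosed_frontier
    h.frontier_subset

lemma isOpen_good (h : HomeoPair U V R φ ψ) {O : Set ℂ} (hO : IsOpen O) :
    IsOpen {x | ∀ w, (x, w) ∈ closure ((fun z => (z, φ z)) '' U) → w ∈ O} := by
  have : {x | ∀ w, (x, w) ∈ closure ((fun z => (z, φ z)) '' U) → w ∈ O}ᶜ =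
      Prod.fst '' (closure ((fun z => (z, φ z)) '' U) ∩ Prod.snd ⁻¹' Oᶜ) := by
    ext x
    simp
  rw [← isClosed_compl_iff, this]
  exact ((h.isCompact_closure_graph.inter_right
    (hO.isClosed_compl.preimage continuous_snd)).image continuous_fst).isClosed

lemma rel_of_mem_closure (_ : HomeoPair U V R φ ψ) {x w z : ℂ}
    (hx : x ∈ connectedComponentIn (closedBall 0 R \ U) z)
    (hw : (x, w) ∈ closure ((fun z => (z, φ z)) '' U)) : BdryRel φ U x w :=
  ⟨(connectedComponentIn_subset _ _ hx).2, hw⟩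

lemma mem_component_of_mem_component (h : HomeoPair U V R φ ψ) {x w x' w' : ℂ}
    (hr : BdryRel φ U x w) (hr' : BdryRel φ U x' w')
    (hx : x' ∈ connectedComponentIn (closedBall 0 R \ U) x) :
    w' ∈ connectedComponentIn (frontier V) w := by
  set H := connectedComponentIn (closedBall 0 R \ U) x with hH
  have hxK := h.frontier_subset (hr.mem_frontier h.openU)
  have hHc : IsClosed H := by
    have : IsClosed (closedBall (0:ℂ) R \ U) := isClosed_closedBall.sdiff h.openU
    exact isClosed_connectedComponentIn this _
  set S := {w | ∃ x ∈ H, BdryRel φ U x w} with hS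
  have hSeq : S = Prod.snd '' (closure ((fun z => (z, φ z)) '' U) ∩ Prod.fst ⁻¹' H) := by
    ext v
    constructor
    · rintro ⟨y, hy, hyv⟩; exact ⟨(y, v), ⟨hyv.2, hy⟩, rfl⟩
    · rintro ⟨⟨y, v'⟩, ⟨h1, h2⟩, rfl⟩; exact ⟨y, h2, h.rel_of_mem_closure h2 h1⟩
  have hSc : IsCompact S := by
    rw [hSeq]
    exact (h.isCompact_closure_graph.inter_right (hHc.preimage continuous_fst)).image continuous_snd
  have hSpre : IsPreconnected S := by
    rw [isPreconnected_iff_subset_of_fully_disjoint_closed hSc.isClosed]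
    intro A B hA hB hSAB hAB
    obtain ⟨O₁, O₂, hO₁, hO₂, hAO, hBO, hO⟩ := SeparatedNhds.of_isCompact_isCompact
      (hSc.inter_right hA) (hSc.inter_right hB)
      (hAB.mono inter_subset_right inter_subset_right)
    have hN := h.isOpen_good (hO₁.union hO₂)
    obtain ⟨N', hN', hHN', hpre, hsub⟩ := exists_isOpen_isPreconnected_inter h.preU h.openU h.subU
      hxK hN (by
        intro y hy v hv
        have hvS : v ∈ S := ⟨y, hy, h.rel_of_mem_closure hy hv⟩
        rcases hSAB hvS with hvA | hvB
        · exact Or.inl (hAO ⟨hvS, hvA⟩)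
        · exact Or.inr (hBO ⟨hvS, hvB⟩))
    have himg : IsPreconnected (φ '' (U ∩ N')) :=
      hpre.image _ (h.contφ.mono inter_subset_left)
    have hlim : ∀ v ∈ S, v ∈ closure (φ '' (U ∩ N')) := by
      rintro v ⟨y, hy, hyv⟩
      obtain ⟨z, hz, hzy, hzv⟩ := hyv.exists_seq
      refine mem_closure_of_tendsto hzv ?_
      filter_upwards [hzy (hN'.mem_nhds (hHN' hy))] with n hn
      exact ⟨z n, ⟨hz n, hn⟩, rfl⟩
    have hcov : φ '' (U ∩ N') ⊆ O₁ ∪ O₂ := by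
      rintro _ ⟨y, hy, rfl⟩
      exact hsub hy _ (subset_closure ⟨y, hy.1, rfl⟩)
    have key : ∀ P Q : Set ℂ, IsOpen P → IsOpen Q → Disjoint P Q → φ '' (U ∩ N') ⊆ P →
        ∀ v ∈ S, v ∉ Q := by
      intro P Q _ hQ hPQ hsubP v hv hvQ
      obtain ⟨u, huQ, hu⟩ := mem_closure_iff_nhds.1 (hlim v hv) Q (hQ.mem_nhds hvQ)
      exact disjoint_left.1 hPQ (hsubP hu) huQ
    rcases (isPreconnected_iff_subset_of_disjoint.1 himg O₁ O₂ hO₁ hO₂ hcov (by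
        rw [hO.inter_eq, inter_empty])) with h1 | h1
    · left
      intro v hv
      rcases hSAB hv with hvA | hvB
      · exact hvA
      · exact absurd (hBO ⟨hv, hvB⟩) (key _ _ hO₁ hO₂ hO h1 v hv)
    · right
      intro v hv
      rcases hSAB hv with hvA | hvB
      · exact absurd (hAO ⟨hv, hvA⟩) (key _ _ hO₂ hO₁ hO.symm h1 v hv)
      · exact hvB
  have hSV : S ⊆ frontier V := by
    rintro v ⟨y, _, hyv⟩
    exact (h.rel_symm hyv).mem_frontier h.openV
  exact hSpre.subset_connectedComponentIn ⟨x, mem_connectedComponentIn hxK, hr⟩ hSV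
    ⟨x', hx, hr'⟩

lemma component_subset (h : HomeoPair U V R φ ψ) (x : ℂ) :
    connectedComponentIn (frontier U) x ⊆ connectedComponentIn (closedBall 0 R \ U) x :=
  connectedComponentIn_mono _ h.frontier_subset

lemma mem_component_iff (h : HomeoPair U V R φ ψ) {x w x' w' : ℂ}
    (hr : BdryRel φ U x w) (hr' : BdryRel φ U x' w') :
    x' ∈ connectedComponentIn (frontier U) x ↔ w' ∈ connectedComponentIn (frontier V) w :=
  ⟨fun hx => h.mem_component_of_mem_component hr hr' (h.component_subset x hx),
    fun hw => h.symm.mem_component_of_mem_component (h.rel_symm hr) (h.rel_symm hr')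
      (h.symm.component_subset w hw)⟩

lemma subset_hole_of_disjoint_frontier (h : HomeoPair U V R φ ψ) {τ : Set ℂ}
    (hτ : IsPreconnected τ) (hτR : τ ⊆ closedBall 0 R) {s : ℂ} (hs : s ∈ τ) (hsU : s ∉ U)
    (hd : ∀ t ∈ τ, t ∈ connectedComponentIn (closedBall 0 R \ U) s → t ∉ frontier U) :
    τ ⊆ connectedComponentIn (closedBall 0 R \ U) s := by
  set K := closedBall (0:ℂ) R \ U with hK
  have hHc : IsClosed (connectedComponentIn K s) :=
    isClosed_connectedComponentIn (isClosed_closedBall.sdiff h.openU) s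
  intro t ht
  refine (hτ.induction₂ (fun a b => a ∈ connectedComponentIn K s ↔ b ∈ connectedComponentIn K s)
    ?_ (fun _ _ _ _ _ _ h h' => h.trans h') (fun _ _ _ _ h => h.symm) hs ht).1
    (mem_connectedComponentIn ⟨hτR hs, hsU⟩)
  intro a ha
  by_cases haH : a ∈ connectedComponentIn K s
  · have haK := connectedComponentIn_subset _ _ haH
    have hac : a ∉ closure U := fun hc => hd a ha haH (by
      rw [h.openU.frontier_eq]; exact ⟨hc, haK.2⟩)
    obtain ⟨ε, hε, hb⟩ := Metric.isOpen_iff.1 isClosed_closure.isOpen_compl a hac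
    filter_upwards [self_mem_nhdsWithin, mem_nhdsWithin_of_mem_nhds (ball_mem_nhds a hε)]
      with b hbτ hbb
    refine ⟨fun _ => ?_, fun _ => haH⟩
    have hconv : IsPreconnected (ball a ε ∩ closedBall (0:ℂ) R) :=
      ((convex_ball a ε).inter (convex_closedBall 0 R)).isPreconnected
    rw [connectedComponentIn_eq haH]
    have hmem : b ∈ ball a ε ∩ closedBall (0:ℂ) R := ⟨hbb, hτR hbτ⟩
    have hsub : ball a ε ∩ closedBall (0:ℂ) R ⊆ K := fun y hy =>
      ⟨hy.2, fun hyU => hb hy.1 (subset_closure hyU)⟩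
    have ha' : a ∈ ball a ε ∩ closedBall (0:ℂ) R := ⟨mem_ball_self hε, haK.1⟩
    exact hconv.subset_connectedComponentIn ha' hsub hmem
  · filter_upwards [mem_nhdsWithin_of_mem_nhds (hHc.isOpen_compl.mem_nhds haH)] with b hb
    exact ⟨fun hc => absurd hc haH, fun hc => absurd hc hb⟩

/-- `a` lies in `U` with image in `O`, or in a hole of `U` all of whose corresponding boundary
components of `V` lie in `O`. -/
def Labelled (φ : ℂ → ℂ) (U V : Set ℂ) (R : ℝ) (O : Set ℂ) (a : ℂ) : Prop :=
  (a ∈ U ∧ φ a ∈ O) ∨ (a ∉ U ∧ ∀ s ∈ connectedComponentIn (closedBall 0 R \ U) a, ∀ w,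
    BdryRel φ U s w → connectedComponentIn (frontier V) w ⊆ O)

lemma Labelled.eventually (h : HomeoPair U V R φ ψ) {O : Set ℂ} (hO : IsOpen O) {a : ℂ}
    (haR : a ∈ closedBall 0 R) (ha : Labelled φ U V R O a) :
    ∀ᶠ b in 𝓝[closedBall 0 R] a, Labelled φ U V R O b := by
  rcases ha with ⟨haU, haO⟩ | ⟨haU, haO⟩
  · have hc := h.contφ.continuousAt (h.openU.mem_nhds haU)
    filter_upwards [mem_nhdsWithin_of_mem_nhds (h.openU.mem_nhds haU),
      mem_nhdsWithin_of_mem_nhds (hc (hO.mem_nhds haO))] with b hb hb'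
    exact Or.inl ⟨hb, hb'⟩
  · have hK : IsCompact (closedBall (0:ℂ) R \ U) := (isCompact_closedBall 0 R).diff h.openU
    have haK : a ∈ closedBall (0:ℂ) R \ U := ⟨haR, haU⟩
    have hHN : connectedComponentIn (closedBall 0 R \ U) a ⊆
        {x | ∀ w, (x, w) ∈ closure ((fun z => (z, φ z)) '' U) → w ∈ O} := by
      intro s hs w hw
      have hr := h.rel_of_mem_closure hs hw
      exact haO s hs w hr (mem_connectedComponentIn ((h.rel_symm hr).mem_frontier h.openV))
    obtain ⟨M, hM, hHM, -, hMN⟩ := hK.exists_isOpen_superset_connectedComponentIn haK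
      (h.isOpen_good hO) hHN
    have haH := mem_connectedComponentIn haK
    filter_upwards [mem_nhdsWithin_of_mem_nhds (hM.mem_nhds (hHM haH)),
      mem_nhdsWithin_of_mem_nhds ((h.isOpen_good hO).mem_nhds (hHN haH)), self_mem_nhdsWithin]
      with b hbM hbN hbR
    by_cases hbU : b ∈ U
    · exact Or.inl ⟨hbU, hbN _ (subset_closure ⟨b, hbU, rfl⟩)⟩
    · refine Or.inr ⟨hbU, fun s hs w hr v hv => ?_⟩
      obtain ⟨y, hy⟩ := h.exists_rel' (connectedComponentIn_subset _ _ hv)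
      have hys : y ∈ connectedComponentIn (closedBall 0 R \ U) b := by
        rw [connectedComponentIn_eq hs]
        exact h.component_subset s ((h.mem_component_iff hr hy).2 hv)
      exact hMN b ⟨⟨hbR, hbU⟩, hbM⟩ hys v hy.2

theorem isPreconnected_transfer (h : HomeoPair U V R φ ψ) {τ : Set ℂ}
    (hτ : IsPreconnected τ) (hτR : τ ⊆ closedBall 0 R) :
    IsPreconnected (transfer φ U V τ) := by
  by_cases hcase : ∃ s ∈ τ, s ∉ U ∧
      ∀ t ∈ τ, t ∈ connectedComponentIn (closedBall 0 R \ U) s → t ∉ frontier U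
  · obtain ⟨s, hs, hsU, hd⟩ := hcase
    have hsub := h.subset_hole_of_disjoint_frontier hτ hτR hs hsU hd
    have : transfer φ U V τ = ∅ := by
      rw [eq_empty_iff_forall_notMem]
      rintro w (⟨t, ⟨ht, htU⟩, -⟩ | ⟨t, ht, w', hr, -⟩)
      · exact (connectedComponentIn_subset _ _ (hsub ht)).2 htU
      · exact hd t ht (hsub ht) (hr.mem_frontier h.openU)
    rw [this]
    exact isPreconnected_empty
  push Not at hcase
  intro O₁ O₂ hO₁ hO₂ hcov hne₁ hne₂
  by_contra hemp
  have hdisj : ∀ w ∈ transfer φ U V τ, w ∈ O₁ → w ∈ O₂ → False := fun w hw h1 h2 =>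
    hemp ⟨w, hw, h1, h2⟩
  have hP : ∀ a ∈ τ, a ∉ U → ∃ s ∈ τ, ∃ w, BdryRel φ U s w ∧
      s ∈ connectedComponentIn (closedBall 0 R \ U) a ∧
      ∀ s' ∈ connectedComponentIn (closedBall 0 R \ U) a, ∀ w', BdryRel φ U s' w' →
        connectedComponentIn (frontier V) w' = connectedComponentIn (frontier V) w := by
    intro a ha haU
    obtain ⟨s, hs, hsH, hsf⟩ := hcase a ha haU
    obtain ⟨w, hw⟩ := h.exists_rel hsf
    refine ⟨s, hs, w, hw, hsH, fun s' hs' w' hw' => ?_⟩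
    refine (connectedComponentIn_eq (h.mem_component_of_mem_component hw hw' ?_)).symm
    rwa [← connectedComponentIn_eq hsH]
  have hsubT : ∀ s ∈ τ, ∀ w, BdryRel φ U s w →
      connectedComponentIn (frontier V) w ⊆ transfer φ U V τ := fun s hs w hw v hv =>
    Or.inr ⟨s, hs, w, hw, hv⟩
  have hmemP : ∀ s w, BdryRel φ U s w → w ∈ connectedComponentIn (frontier V) w :=
    fun s w hw => mem_connectedComponentIn ((h.rel_symm hw).mem_frontier h.openV)
  have hor : ∀ a ∈ τ, Labelled φ U V R O₁ a ∨ Labelled φ U V R O₂ a := by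
    intro a ha
    by_cases haU : a ∈ U
    · rcases hcov (Or.inl ⟨a, ⟨ha, haU⟩, rfl⟩) with h1 | h1
      · exact Or.inl (Or.inl ⟨haU, h1⟩)
      · exact Or.inr (Or.inl ⟨haU, h1⟩)
    · obtain ⟨s, hs, w, hw, hsH, hall⟩ := hP a ha haU
      have := isPreconnected_iff_subset_of_disjoint.1
        (isPreconnected_connectedComponentIn (x := w) (F := frontier V)) O₁ O₂ hO₁ hO₂
        ((hsubT s hs w hw).trans hcov) (by
          rw [eq_empty_iff_forall_notMem]
          exact fun v hv => hdisj v (hsubT s hs w hw hv.1) hv.2.1 hv.2.2)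
      rcases this with h1 | h1
      · exact Or.inl (Or.inr ⟨haU, fun s' hs' w' hw' => (hall s' hs' w' hw').trans_subset h1⟩)
      · exact Or.inr (Or.inr ⟨haU, fun s' hs' w' hw' => (hall s' hs' w' hw').trans_subset h1⟩)
  have hnot : ∀ a ∈ τ, Labelled φ U V R O₁ a → Labelled φ U V R O₂ a → False := by
    rintro a ha (⟨haU, h1⟩ | ⟨haU, h1⟩) (⟨haU', h2⟩ | ⟨haU', h2⟩)
    · exact hdisj _ (Or.inl ⟨a, ⟨ha, haU⟩, rfl⟩) h1 h2
    · exact haU' haU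
    · exact haU haU'
    · obtain ⟨s, hs, w, hw, hsH, hall⟩ := hP a ha haU
      have hwP := hmemP s w hw
      exact hdisj w (hsubT s hs w hw hwP) (h1 s hsH w hw hwP) (h2 s hsH w hw hwP)
  have hlab : ∀ O, IsOpen O → ∀ O', (∀ w ∈ transfer φ U V τ, w ∈ O → w ∈ O' → False) →
      (∀ a ∈ τ, Labelled φ U V R O a ∨ Labelled φ U V R O' a) →
      (transfer φ U V τ ∩ O).Nonempty → ∃ a ∈ τ, Labelled φ U V R O a := by
    rintro O hO O' hOO' hor' ⟨w, (⟨s, ⟨hs, hsU⟩, rfl⟩ | ⟨s, hs, w', hr, hw⟩), hwO⟩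
    · exact ⟨s, hs, Or.inl ⟨hsU, hwO⟩⟩
    · refine ⟨s, hs, (hor' s hs).resolve_right ?_⟩
      rintro (⟨hsU, -⟩ | ⟨-, hall⟩)
      · exact hr.1 hsU
      · exact hOO' w (Or.inr ⟨s, hs, w', hr, hw⟩) hwO
          (hall s (mem_connectedComponentIn ⟨hτR hs, hr.1⟩) w' hr hw)
  obtain ⟨a, ha, haL⟩ := hlab O₁ hO₁ O₂ hdisj hor hne₁
  obtain ⟨b, hb, hbL⟩ := hlab O₂ hO₂ O₁ (fun w hw h2 h1 => hdisj w hw h1 h2)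
    (fun a ha => (hor a ha).symm) hne₂
  refine hnot b hb ((hτ.induction₂ (fun a b => Labelled φ U V R O₁ a ↔ Labelled φ U V R O₁ b)
    ?_ (fun _ _ _ _ _ _ h h' => h.trans h') (fun _ _ _ _ h => h.symm) ha hb).1 haL) hbL
  intro c hc
  rcases hor c hc with h1 | h1
  · filter_upwards [nhdsWithin_mono c hτR (Labelled.eventually h hO₁ (hτR hc) h1)] with d hd
    exact iff_of_true h1 hd
  · filter_upwards [nhdsWithin_mono c hτR (Labelled.eventually h hO₂ (hτR hc) h1),
      self_mem_nhdsWithin] with d hd hdτ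
    exact iff_of_false (fun h1' => hnot c hc h1' h1) (fun h1' => hnot d hdτ h1' hd)

end HomeoPair

lemma IsConformalHomeoOnto.exists_homeoPair {D Ω : Set ℂ} {φ : ℂ → ℂ} (hD : IsPlanarDomain D)
    (hΩ : IsPlanarDomain Ω) (hDb : Bornology.IsBounded D) (hΩb : Bornology.IsBounded Ω)
    (hφ : IsConformalHomeoOnto φ D Ω) :
    ∃ (R : ℝ) (ψ : ℂ → ℂ), 0 < R ∧ HomeoPair D Ω R φ ψ := by
  obtain ⟨R, hR0, hR⟩ := (hDb.union hΩb).subset_ball_lt 0 0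
  obtain ⟨hdiff, hbij⟩ := hφ
  have hinv : InvOn (Function.invFunOn φ D) φ D Ω := hbij.invOn_invFunOn
  have hmaps : MapsTo (Function.invFunOn φ D) Ω D := hbij.surjOn.mapsTo_invFunOn
  have han : AnalyticOnNhd ℂ φ D := hdiff.analyticOnNhd hD.2.1
  have hopen : ∀ s ⊆ D, IsOpen s → IsOpen (φ '' s) := by
    rcases han.is_constant_or_isOpen hD.2.2.isPreconnected with ⟨w, hw⟩ | h
    · exfalso
      obtain ⟨x, hx⟩ := hD.1
      have hsing : D ⊆ {x} := fun y hy => hbij.injOn hy hx ((hw y hy).trans (hw x hx).symm)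
      have : D = {x} := hsing.antisymm (by simpa using hx)
      exact not_isOpen_singleton x (this ▸ hD.2.1)
    · exact h
  refine ⟨R, Function.invFunOn φ D, hR0, hD.2.1, hΩ.2.1, hD.2.2.isPreconnected,
    hΩ.2.2.isPreconnected, subset_union_left.trans hR, subset_union_right.trans hR,
    hdiff.continuousOn, ?_, hbij.mapsTo, hmaps, hinv.1, hinv.2⟩
  intro w hw
  refine ContinuousAt.continuousWithinAt fun N hN => ?_
  obtain ⟨N', hN'N, hN', hwN'⟩ := _root_.mem_nhds_iff.1 hN
  refine mem_map.2 (mem_of_superset ((hopen _ inter_subset_left (hD.2.1.inter hN')).mem_nhds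
    ⟨_, ⟨hmaps hw, hwN'⟩, hinv.2 hw⟩) ?_)
  rintro _ ⟨z, ⟨hz, hzN⟩, rfl⟩
  exact hN'N (by simpa only [mem_preimage, hinv.1 hz] using hzN)

lemma finite_setOf_lt_diam_of_tsum_lt_top {𝒩 : Set (Set ℂ)}
    (h : ∑' Q : ↥𝒩, ediam (Q : Set ℂ) < ⊤) {C : ℝ} (hC : 0 < C) :
    {Q ∈ 𝒩 | C < diam Q}.Finite := by
  have hfin := ENNReal.finite_const_le_of_tsum_ne_top h.ne (ε := ENNReal.ofReal C) (by simpa using hC)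
  refine (hfin.image Subtype.val).subset ?_
  rintro Q ⟨hQ, hCQ⟩
  refine ⟨⟨Q, hQ⟩, ?_, rfl⟩
  exact ENNReal.ofReal_le_of_le_toReal hCQ.le

theorem isPeanoCompactum_of_extends {D Ω : Set ℂ} {φ φb : ℂ → ℂ} (hDb : Bornology.IsBounded D)
    (hD : IsPlanarDomain D) (hP : IsPeanoCompactum (frontier D))
    (hΩ : IsPlanarDomain Ω) (hΩb : Bornology.IsBounded Ω)
    (hdiam : ∑' Q : ↥(NondegComponents (frontier Ω)), ediam (Q : Set ℂ) < ⊤)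
    (hφ : IsConformalHomeoOnto φ D Ω) (hext : ExtendsContinuously φ φb D Ω) :
    IsPeanoCompactum (frontier Ω) := by
  obtain ⟨R, ψ, -, h⟩ := hφ.exists_homeoPair hD hΩ hDb hΩb
  have hval : ∀ x w, BdryRel φ D x w → φb x = w := by
    intro x w hr
    obtain ⟨z, hz, hzx, hzw⟩ := hr.exists_seq
    have hx : x ∈ closure D := (hr.mem_frontier h.openU).1
    have h1 : Tendsto (fun n => φb (z n)) atTop (𝓝 (φb x)) :=
      (hext.1 x hx).tendsto.comp (tendsto_nhdsWithin_iff.2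
        ⟨hzx, Eventually.of_forall fun n => subset_closure (hz n)⟩)
    refine tendsto_nhds_unique h1 (hzw.congr fun n => (hext.2.1 (hz n)).symm)
  refine ⟨h.symm.isCompact_frontier, fun w hw => ?_, fun C hC => ?_⟩
  · obtain ⟨x, hr⟩ := h.exists_rel' hw
    have hx := hr.mem_frontier h.openU
    have himg : φb '' connectedComponentIn (frontier D) x = connectedComponentIn (frontier Ω) w := by
      apply Subset.antisymm
      · rintro _ ⟨y, hy, rfl⟩
        obtain ⟨v, hv⟩ := h.exists_rel (connectedComponentIn_subset _ _ hy)
        rw [hval y v hv]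
        exact (h.mem_component_iff hr hv).1 hy
      · intro v hv
        obtain ⟨y, hy⟩ := h.exists_rel' (connectedComponentIn_subset _ _ hv)
        exact ⟨y, (h.mem_component_iff hr hy).2 hv, hval y v hy⟩
    have hloc := hP.2.1 x hx
    have hcomp : CompactSpace (connectedComponentIn (frontier D) x) :=
      isCompact_iff_compactSpace.1 (h.isCompact_frontier.of_isClosed_subset
        (isClosed_connectedComponentIn isClosed_frontier x) (connectedComponentIn_subset _ _))
    have hcont : ContinuousOn φb (connectedComponentIn (frontier D) x) :=
      hext.1.mono ((connectedComponentIn_subset _ _).trans frontier_subset_closure)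
    rw [← himg]
    let g : connectedComponentIn (frontier D) x → φb '' connectedComponentIn (frontier D) x :=
      fun y => ⟨φb y, y, y.2, rfl⟩
    have hg : Continuous g := Continuous.subtype_mk (continuousOn_iff_continuous_domRestrict.1 hcont) _
    have hsurj : Function.Surjective g := by
      rintro ⟨_, y, hy, rfl⟩
      exact ⟨⟨y, hy⟩, rfl⟩
    exact (hg.isClosedMap.isQuotientMap hg hsurj).isCoinducing.locallyConnectedSpace
  · refine (finite_setOf_lt_diam_of_tsum_lt_top hdiam hC).subset ?_
    rintro Q ⟨hQ, hCQ⟩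
    refine ⟨⟨hQ, ?_⟩, hCQ⟩
    by_contra! hsub
    have : Q.Subsingleton := fun a ha b hb => hsub a ha b hb
    rw [diam_subsingleton this] at hCQ
    exact absurd hCQ (not_lt.2 hC.le)

/-- Uniform local connectedness of a locally connected compact set. -/
lemma exists_isPreconnected_superset_of_locallyConnectedSpace {P : Set ℂ} (hP : IsCompact P)
    (hloc : LocallyConnectedSpace P) {ω : ℝ} (hω : 0 < ω) :
    ∃ η > 0, ∀ A ⊆ P, (∀ a ∈ A, ∀ b ∈ A, dist a b < η) →
      ∃ c, IsClosed c ∧ IsPreconnected c ∧ A ⊆ c ∧ c ⊆ P ∧ (A = ∅ → c = ∅) ∧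
        ∀ a ∈ c, ∀ b ∈ c, dist a b ≤ ω := by
  have hcomp : CompactSpace P := isCompact_iff_compactSpace.1 hP
  have hbase := locallyConnectedSpace_iff_subsets_isOpen_isConnected.1 hloc
  choose W hWs hWo hWm hWc using fun p : P => hbase p (ball p (ω / 2)) (ball_mem_nhds p (half_pos hω))
  obtain ⟨η, hη, hleb⟩ := lebesgue_number_lemma_of_metric (isCompact_univ (X := P)) hWo
    (fun p _ => mem_iUnion.2 ⟨p, hWm p⟩)
  refine ⟨η, hη, fun A hAP hA => ?_⟩
  rcases A.eq_empty_or_nonempty with rfl | ⟨a, ha⟩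
  · exact ⟨∅, isClosed_empty, isPreconnected_empty, Subset.rfl, empty_subset _, fun _ => rfl, by simp⟩
  obtain ⟨p, hp⟩ := hleb ⟨a, hAP ha⟩ (mem_univ _)
  have hsub : Subtype.val '' W p ⊆ ball (p : ℂ) (ω / 2) := by
    rintro _ ⟨q, hq, rfl⟩
    exact hWs p hq
  have hcl : closure (Subtype.val '' W p) ⊆ closedBall (p : ℂ) (ω / 2) :=
    (closure_mono hsub).trans closure_ball_subset_closedBall
  refine ⟨closure (Subtype.val '' W p), isClosed_closure,
    ((hWc p).isPreconnected.image _ continuous_subtype_val.continuousOn).closure,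
    fun b hb => subset_closure ⟨⟨b, hAP hb⟩, hp ?_, rfl⟩,
    closure_minimal (by rintro _ ⟨q, -, rfl⟩; exact q.2) hP.isClosed,
    fun h => by simp [h] at ha, fun x hx y hy => ?_⟩
  · exact hA b hb a ha
  · have h1 := mem_closedBall.1 (hcl hx)
    have h2 := mem_closedBall.1 (hcl hy)
    linarith [dist_triangle_right x y (p : ℂ)]

lemma Complex.exists_eq_mul_exp_of_mem_sphere {z₀ s t : ℂ} {r : ℝ} (hr : 0 < r)
    (hs : s ∈ sphere z₀ r) (ht : t ∈ sphere z₀ r) :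
    t = z₀ + (s - z₀) * Complex.exp (Complex.arg ((t - z₀) / (s - z₀)) * Complex.I) := by
  rw [mem_sphere_iff_norm] at hs ht
  have hs0 : s - z₀ ≠ 0 := by
    rw [← norm_pos_iff, hs]; exact hr
  have h1 : ‖(t - z₀) / (s - z₀)‖ = 1 := by
    rw [norm_div, hs, ht, div_self hr.ne']
  have := Complex.norm_mul_exp_arg_mul_I ((t - z₀) / (s - z₀))
  rw [h1, Complex.ofReal_one, one_mul] at this
  rw [this]
  field_simp
  ring

lemma exists_isPreconnected_mem_nhdsWithin_sphere {z₀ s : ℂ} {r : ℝ} (hr : 0 < r)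
    (hs : s ∈ sphere z₀ r) {N : Set ℂ} (hN : N ∈ 𝓝 s) :
    ∃ A ⊆ sphere z₀ r ∩ N, IsPreconnected A ∧ s ∈ A ∧ A ∈ 𝓝[sphere z₀ r] s := by
  let g : ℝ → ℂ := fun θ => z₀ + (s - z₀) * Complex.exp (θ * Complex.I)
  have hg : Continuous g := by fun_prop
  have hg0 : g 0 = s := by simp [g]
  have hgs : ∀ θ, g θ ∈ sphere z₀ r := by
    intro θ
    rw [mem_sphere_iff_norm] at hs ⊢
    simp [g, Complex.norm_exp_ofReal_mul_I, hs]
  have hpre : g ⁻¹' N ∈ 𝓝 (0:ℝ) := hg.continuousAt.preimage_mem_nhds (by rwa [hg0])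
  obtain ⟨ε, hε, hball⟩ := Metric.mem_nhds_iff.1 hpre
  refine ⟨g '' ball 0 ε, ?_, (convex_ball (0:ℝ) ε).isPreconnected.image _ hg.continuousOn,
    ⟨0, mem_ball_self hε, hg0⟩, ?_⟩
  · rintro _ ⟨θ, hθ, rfl⟩
    exact ⟨hgs θ, hball hθ⟩
  have hs0 : s - z₀ ≠ 0 := by
    rw [← norm_pos_iff, mem_sphere_iff_norm.1 hs]; exact hr
  have harg : ContinuousAt (fun t => Complex.arg ((t - z₀) / (s - z₀))) s := by
    refine ContinuousAt.comp (f := fun t => (t - z₀) / (s - z₀)) (g := Complex.arg) ?_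
      (by fun_prop)
    refine Complex.continuousAt_arg ?_
    simp [div_self hs0]
  have hnear := harg.preimage_mem_nhds (t := ball 0 ε) (by
    simpa [div_self hs0] using ball_mem_nhds (0:ℝ) hε)
  filter_upwards [mem_nhdsWithin_of_mem_nhds hnear, self_mem_nhdsWithin] with t ht hts
  exact ⟨_, ht, (Complex.exists_eq_mul_exp_of_mem_sphere hr hs hts).symm⟩

lemma closure_connectedComponentIn_inter_subset {X : Type*} [TopologicalSpace X] {G : Set X}
    (s : X) : closure (connectedComponentIn G s) ∩ G ⊆ connectedComponentIn G s := by
  rintro t ⟨ht, htG⟩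
  by_cases hs : s ∈ G
  · have hpre : IsPreconnected (insert t (connectedComponentIn G s)) :=
      isPreconnected_connectedComponentIn.subset_closure (subset_insert _ _)
        (insert_subset ht subset_closure)
    exact hpre.subset_connectedComponentIn (mem_insert_of_mem _ (mem_connectedComponentIn hs))
      (insert_subset htG (connectedComponentIn_subset _ _)) (mem_insert _ _)
  · rw [connectedComponentIn_eq_empty hs, closure_empty] at ht
    exact ht.elim

lemma isClosed_union_connectedComponentIn_sphere {Q : Set ℂ} (hQ : IsClosed Q) (z₀ : ℂ) (r : ℝ)
    (s : ℂ) : IsClosed (Q ∪ connectedComponentIn (sphere z₀ r \ Q) s) := by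
  refine isClosed_of_closure_subset ?_
  rw [closure_union, hQ.closure_eq]
  rintro t (ht | ht)
  · exact Or.inl ht
  · by_cases htQ : t ∈ Q
    · exact Or.inl htQ
    · have hts : t ∈ sphere z₀ r := closure_minimal
        ((connectedComponentIn_subset _ _).trans sdiff_subset) isClosed_sphere ht
      exact Or.inr (closure_connectedComponentIn_inter_subset s ⟨ht, hts, htQ⟩)

lemma connectedComponentIn_sphere_mem_nhdsWithin {Q : Set ℂ} (hQ : IsClosed Q) {z₀ s t : ℂ} {r : ℝ}
    (hr : 0 < r) (ht : t ∈ connectedComponentIn (sphere z₀ r \ Q) s) :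
    connectedComponentIn (sphere z₀ r \ Q) s ∈ 𝓝[sphere z₀ r] t := by
  have htG := connectedComponentIn_subset _ _ ht
  obtain ⟨A, hA, hApre, htA, hAn⟩ := exists_isPreconnected_mem_nhdsWithin_sphere hr htG.1
    (hQ.isOpen_compl.mem_nhds htG.2)
  rw [connectedComponentIn_eq ht]
  exact mem_of_superset hAn (hApre.subset_connectedComponentIn htA fun a ha => hA ha)

/-- A crosscut of the circle `sphere z₀ r` separates `x` from `b` modulo `Q`. -/
theorem exists_connectedComponentIn_sphere_not_hasLog {Q U : Set ℂ} {z₀ x b : ℂ} {r : ℝ}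
    (hr : 0 < r) (hQ : IsClosed Q) (hQpre : IsPreconnected Q) (hQU : Disjoint Q U)
    (hU : IsOpen U) (hUpre : IsPreconnected U) (hx : x ∈ U) (hxr : x ∈ ball z₀ r)
    (hb : b ∈ U) (hbr : b ∉ closedBall z₀ r) :
    ∃ s ∈ sphere z₀ r \ Q, ¬ HasLog (Q ∪ connectedComponentIn (sphere z₀ r \ Q) s) x b := by
  by_contra! hall
  have hxQ : x ∉ Q := fun h => disjoint_left.1 hQU h hx
  have hbQ : b ∉ Q := fun h => disjoint_left.1 hQU h hb
  have hpath := (hU.isConnected_iff_isPathConnected.1 ⟨⟨x, hx⟩, hUpre⟩).joinedIn x hx b hb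
  set τ := range hpath.somePath with hτdef
  have hτU : τ ⊆ U := by
    rintro _ ⟨t, rfl⟩; exact hpath.somePath_mem t
  have hτc : IsCompact τ := isCompact_range hpath.somePath.continuous
  have hτpre : IsPreconnected τ := isPreconnected_range hpath.somePath.continuous
  have hxτ : x ∈ τ := ⟨0, hpath.somePath.source⟩
  have hbτ : b ∈ τ := ⟨1, hpath.somePath.target⟩
  have hτG : τ ∩ sphere z₀ r ⊆ sphere z₀ r \ Q := fun t ht =>
    ⟨ht.2, fun h => disjoint_left.1 hQU h (hτU ht.1)⟩
  obtain ⟨F, hFsub, hFcov⟩ := (hτc.inter_right isClosed_sphere).elim_nhdsWithin_subcover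
    (fun s => connectedComponentIn (sphere z₀ r \ Q) s) (fun s hs =>
      nhdsWithin_mono s inter_subset_right
        (connectedComponentIn_sphere_mem_nhdsWithin hQ hr (mem_connectedComponentIn (hτG hs))))
  have hind : ∀ F : Finset ℂ, (∀ s ∈ F, s ∈ sphere z₀ r \ Q) →
      IsClosed (Q ∪ ⋃ s ∈ F, connectedComponentIn (sphere z₀ r \ Q) s) ∧
      HasLog (Q ∪ ⋃ s ∈ F, connectedComponentIn (sphere z₀ r \ Q) s) x b := by
    intro F
    classical
    induction F using Finset.induction_on with
    | empty =>
      intro _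
      simpa using ⟨hQ, HasLog.of_isPreconnected hQ hUpre hQU.symm hx hb⟩
    | insert s F _ ih =>
      intro hF
      obtain ⟨ihc, ihl⟩ := ih fun t ht => hF t (Finset.mem_insert_of_mem ht)
      have hs := hF s (Finset.mem_insert_self s F)
      have heq : Q ∪ ⋃ t ∈ insert s F, connectedComponentIn (sphere z₀ r \ Q) t =
          (Q ∪ connectedComponentIn (sphere z₀ r \ Q) s) ∪
            (Q ∪ ⋃ t ∈ F, connectedComponentIn (sphere z₀ r \ Q) t) := by
        rw [Finset.set_biUnion_insert, ← union_union_distrib_left]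
      have hsc := isClosed_union_connectedComponentIn_sphere hQ z₀ r s
      rw [heq]
      refine ⟨hsc.union ihc, ?_⟩
      by_cases hdis : ∃ t ∈ F, (connectedComponentIn (sphere z₀ r \ Q) s ∩
          connectedComponentIn (sphere z₀ r \ Q) t).Nonempty
      · obtain ⟨t, ht, y, hys, hyt⟩ := hdis
        have hst : connectedComponentIn (sphere z₀ r \ Q) s =
            connectedComponentIn (sphere z₀ r \ Q) t := by
          rw [connectedComponentIn_eq hys, connectedComponentIn_eq hyt]
        rw [union_eq_right.2]
        · exact ihl
        · refine union_subset_union_right _ ?_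
          rw [hst]
          exact subset_biUnion_of_mem (u := fun t => connectedComponentIn (sphere z₀ r \ Q) t) ht
      · have hint : (Q ∪ connectedComponentIn (sphere z₀ r \ Q) s) ∩
            (Q ∪ ⋃ t ∈ F, connectedComponentIn (sphere z₀ r \ Q) t) = Q := by
          rw [← union_inter_distrib_left, union_eq_left]
          rintro y ⟨hys, hyF⟩
          obtain ⟨t, ht, hyt⟩ := mem_iUnion₂.1 hyF
          exact (hdis ⟨t, ht, y, hys, hyt⟩).elim
        exact HasLog.union hsc ihc (by rwa [hint]) (by rwa [hint]) (hall s hs) ihl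
  obtain ⟨hWc, hWl⟩ := hind F fun s hs => hτG (hFsub s hs)
  set W := ⋃ s ∈ F, connectedComponentIn (sphere z₀ r \ Q) s with hW
  have hWQ : ∀ t ∈ W, t ∉ Q := by
    intro t ht
    obtain ⟨s, -, hts⟩ := mem_iUnion₂.1 ht
    exact (connectedComponentIn_subset _ _ hts).2
  have hcompl : IsClosed (sphere z₀ r \ W) := by
    rw [← isOpen_compl_iff, isOpen_iff_mem_nhds]
    intro t ht
    by_cases hts : t ∈ sphere z₀ r
    · have htW : t ∈ W := by
        by_contra h
        exact ht ⟨hts, h⟩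
      obtain ⟨s, hs, hts⟩ := mem_iUnion₂.1 htW
      have := connectedComponentIn_sphere_mem_nhdsWithin hQ hr hts
      rw [mem_nhdsWithin_iff_eventually] at this
      filter_upwards [this] with y hy hyW
      exact hyW.2 (mem_biUnion hs (hy hyW.1))
    · exact mem_of_superset (isClosed_sphere.isOpen_compl.mem_nhds hts) fun y hy hy' => hy hy'.1
  have hQc : IsClosed (Q ∪ (sphere z₀ r \ W)) := hQ.union hcompl
  have hlog2 : HasLog (Q ∪ (sphere z₀ r \ W)) x b := by
    refine HasLog.of_isPreconnected hQc hτpre ?_ hxτ hbτ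
    rw [disjoint_left]
    rintro t ht (htQ | ⟨hts, htW⟩)
    · exact disjoint_left.1 hQU htQ (hτU ht)
    · exact htW (hFcov ⟨ht, hts⟩)
  have hint : (Q ∪ W) ∩ (Q ∪ (sphere z₀ r \ W)) = Q := by
    rw [← union_inter_distrib_left, union_eq_left]
    rintro y ⟨hy, -, hy'⟩
    exact (hy' hy).elim
  refine not_hasLog_of_frontier_subset (isOpen_ball (x := z₀) (ε := r)) isBounded_ball hxr
    (fun h => hbr (ball_subset_closedBall h)) ?_ ?_
    (HasLog.union hWc hQc (by rwa [hint]) (by rwa [hint]) hWl hlog2)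
  · have hbs : b ∉ sphere z₀ r := fun h => hbr (sphere_subset_closedBall h)
    rintro ((h | h) | (h | h))
    · exact hbQ h
    · obtain ⟨s, -, hts⟩ := mem_iUnion₂.1 h
      exact hbs (connectedComponentIn_subset _ _ hts).1
    · exact hbQ h
    · exact hbs h.1
  · rw [frontier_ball _ hr.ne']
    intro t ht
    by_cases htW : t ∈ W
    · exact Or.inl (Or.inr htW)
    · exact Or.inr (Or.inr ⟨ht, htW⟩)

/-- A point or Jordan curve `Q`, cut near one of its points `z₀`, leaves a connected remainder. -/
lemma exists_isPreconnected_remainder {Q : Set ℂ} {z₀ : ℂ} (hz : z₀ ∈ Q)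
    (hQ : Q = {z₀} ∨ IsJordanCurve Q) {r : ℝ} (hr : 0 < r) :
    ∃ β ⊆ Q, IsClosed β ∧ IsPreconnected β ∧ z₀ ∉ β ∧ Q \ ball z₀ r ⊆ β := by
  rcases hQ with rfl | ⟨⟨e⟩⟩
  · refine ⟨∅, empty_subset _, isClosed_empty, isPreconnected_empty, notMem_empty _, ?_⟩
    rintro y ⟨rfl, hy⟩
    exact hy (mem_ball_self hr)
  obtain ⟨u, hu⟩ : ∃ u : ℂ, u = (e ⟨z₀, hz⟩).1 := ⟨_, rfl⟩
  have hus : u ∈ sphere (0:ℂ) 1 := hu ▸ (e ⟨z₀, hz⟩).2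
  have hmem : ∀ θ : ℝ, 0 + (u - 0) * Complex.exp (θ * Complex.I) ∈ sphere (0:ℂ) 1 := by
    intro θ
    have := mem_sphere_iff_norm.1 hus
    simp only [sub_zero] at this
    simp [Complex.norm_exp_ofReal_mul_I, this]
  let g : ℝ → ℂ := fun θ => (e.symm ⟨_, hmem θ⟩ : ℂ)
  have hg : Continuous g := by
    refine continuous_subtype_val.comp (e.symm.continuous.comp (Continuous.subtype_mk ?_ _))
    fun_prop
  have hg0 : g 0 = z₀ := by
    have : (⟨_, hmem 0⟩ : sphere (0:ℂ) 1) = e ⟨z₀, hz⟩ := by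
      ext
      simp [hu]
    simp only [g, this, e.symm_apply_apply]
  obtain ⟨ε, hε, hball⟩ := Metric.mem_nhds_iff.1
    (hg.continuousAt.preimage_mem_nhds (x := 0) (t := ball z₀ r) (by
      rw [hg0]; exact ball_mem_nhds z₀ hr))
  set a := min (ε / 2) 1 with ha
  have ha0 : 0 < a := lt_min (half_pos hε) one_pos
  have haε : a < ε := (min_le_left _ _).trans_lt (half_lt_self hε)
  have haπ : a ≤ Real.pi := (min_le_right _ _).trans (by linarith [Real.pi_gt_three])
  refine ⟨g '' Icc a (2 * Real.pi - a), ?_, (isCompact_Icc.image hg).isClosed,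
    isPreconnected_Icc.image _ hg.continuousOn, ?_, ?_⟩
  · rintro _ ⟨θ, -, rfl⟩
    exact (e.symm _).2
  · rintro ⟨θ, ⟨h1, h2⟩, hθ⟩
    have h3 : e.symm ⟨_, hmem θ⟩ = ⟨z₀, hz⟩ := Subtype.ext hθ
    have h4 := congrArg (fun y => (e y : ℂ)) h3
    simp only [e.apply_symm_apply, ← hu, zero_add, sub_zero] at h4
    have hu0 : u ≠ 0 := by
      rintro h0
      rw [h0] at hus
      simp at hus
    have h5 : Complex.exp (θ * Complex.I) = 1 := by
      simpa [hu0] using h4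
    obtain ⟨n, hn⟩ := Complex.exp_eq_one_iff.1 h5
    have h6 : (θ : ℂ) = ((n * (2 * Real.pi) : ℝ) : ℂ) := by
      have := Complex.I_ne_zero
      apply mul_right_cancel₀ this
      rw [hn]
      push_cast
      ring
    have h7 : θ = n * (2 * Real.pi) := by exact_mod_cast h6
    have hpi := Real.pi_pos
    have h8 : (0:ℝ) < n := by
      by_contra hcon
      push Not at hcon
      nlinarith
    have h9 : (n:ℝ) < 1 := by
      by_contra hcon
      push Not at hcon
      nlinarith
    have h10 : 0 < n := by exact_mod_cast h8
    have h11 : n < 1 := by exact_mod_cast h9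
    omega
  · rintro y ⟨hyQ, hyr⟩
    set v : sphere (0:ℂ) 1 := e ⟨y, hyQ⟩ with hv
    set θ := Complex.arg (((v:ℂ) - 0) / (u - 0)) with hθ
    have hkey := Complex.exists_eq_mul_exp_of_mem_sphere one_pos hus v.2
    have hgθ : g θ = y := by
      have : (⟨_, hmem θ⟩ : sphere (0:ℂ) 1) = v := Subtype.ext hkey.symm
      simp only [g, this, hv, e.symm_apply_apply]
    have hθa : a < |θ| := by
      by_contra! hcon
      refine hyr ?_
      rw [← hgθ]
      exact hball (by rw [mem_ball_zero_iff, Real.norm_eq_abs]; linarith)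
    have hθ1 := Complex.neg_pi_lt_arg (((v:ℂ) - 0) / (u - 0))
    have hθ2 := Complex.arg_le_pi (((v:ℂ) - 0) / (u - 0))
    rw [← hθ] at hθ1 hθ2
    rcases le_or_gt 0 θ with h0 | h0
    · rw [abs_of_nonneg h0] at hθa
      exact ⟨θ, ⟨hθa.le, by linarith⟩, hgθ⟩
    · rw [abs_of_neg h0] at hθa
      refine ⟨θ + 2 * Real.pi, ⟨by linarith, by linarith⟩, ?_⟩
      rw [← hgθ]
      have hper : Complex.exp ((θ + 2 * Real.pi : ℝ) * Complex.I) =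
          Complex.exp (θ * Complex.I) := by
        push_cast
        rw [add_mul, Complex.exp_add, Complex.exp_two_pi_mul_I, mul_one]
      simp only [g, hper]

lemma isPreconnected_compl_closedBall (w : ℂ) {ρ : ℝ} (hρ : 0 < ρ) :
    IsPreconnected (closedBall w ρ)ᶜ := by
  have h : (closedBall w ρ)ᶜ = (fun z => w + Complex.exp z) '' {z | Real.log ρ < z.re} := by
    ext v
    simp only [mem_compl_iff, mem_closedBall, not_le, mem_image, mem_ofPred_eq, dist_eq_norm]
    constructor
    · intro hv
      have hne : v - w ≠ 0 := norm_pos_iff.1 (hρ.trans hv)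
      refine ⟨Complex.log (v - w), ?_, by rw [Complex.exp_log hne]; ring⟩
      rw [Complex.log_re]
      exact Real.log_lt_log hρ hv
    · rintro ⟨z, hz, rfl⟩
      rw [add_sub_cancel_left, Complex.norm_exp]
      exact (Real.log_lt_iff_lt_exp hρ).1 hz
  rw [h]
  exact (convex_halfSpace_re_gt _).isPreconnected.image _ (by fun_prop)

lemma IsCompact.isClosed_setOf_mem_connectedComponentIn {K : Set ℂ} (hK : IsCompact K) :
    IsClosed {p : ℂ × ℂ | p.1 ∈ K ∧ p.2 ∈ connectedComponentIn K p.1} := by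
  rw [← isOpen_compl_iff, isOpen_iff_mem_nhds]
  rintro ⟨w, v⟩ hp
  by_cases hw : w ∈ K
  · have hv : v ∉ connectedComponentIn K w := fun h => hp ⟨hw, h⟩
    obtain ⟨ε, hε, hb⟩ := Metric.nhds_basis_closedBall.mem_iff.1
      ((isClosed_connectedComponentIn hK.isClosed w).isOpen_compl.mem_nhds hv)
    obtain ⟨M, hM, hHM, -, hMN⟩ := hK.exists_isOpen_superset_connectedComponentIn hw
      (isClosed_closedBall (x := v) (ε := ε)).isOpen_compl (fun y hy hyb => hb hyb hy)
    filter_upwards [prod_mem_nhds (hM.mem_nhds (hHM (mem_connectedComponentIn hw)))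
      (closedBall_mem_nhds v hε)]
    rintro ⟨w', v'⟩ ⟨hw', hv'⟩ ⟨h1, h2⟩
    exact hMN w' ⟨h1, hw'⟩ h2 hv'
  · filter_upwards [prod_mem_nhds (hK.isClosed.isOpen_compl.mem_nhds hw) univ_mem]
    rintro ⟨w', v'⟩ ⟨hw', -⟩ ⟨h1, h2⟩
    exact hw' h1

namespace HomeoPair

variable {U V : Set ℂ} {R : ℝ} {φ ψ : ℂ → ℂ}

lemma isClosed_transfer (h : HomeoPair U V R φ ψ) {X : Set ℂ} (hX : IsClosed X) :
    IsClosed (transfer φ U V X) := by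
  set T := Prod.snd '' (closure ((fun z => (z, φ z)) '' U) ∩ Prod.fst ⁻¹' X) with hT
  have hTc : IsCompact T :=
    (h.isCompact_closure_graph.inter_right (hX.preimage continuous_fst)).image continuous_snd
  have hV := h.symm.isCompact_frontier
  set E := {p : ℂ × ℂ | p.1 ∈ frontier V ∧ p.2 ∈ connectedComponentIn (frontier V) p.1} with hE
  have hEc : IsCompact E := (hV.prod hV).of_isClosed_subset hV.isClosed_setOf_mem_connectedComponentIn
    fun p hp => ⟨hp.1, connectedComponentIn_subset _ _ hp.2⟩
  have hcase : ∀ s w, (s, w) ∈ closure ((fun z => (z, φ z)) '' U) → s ∈ U → φ s = w := by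
    intro s w hw hs
    obtain ⟨p, hp, hlim⟩ := mem_closure_iff_seq_limit.1 hw
    have h1 : Tendsto (fun n => (p n).1) atTop (𝓝 s) := (continuous_fst.tendsto _).comp hlim
    have h2 : Tendsto (fun n => (p n).2) atTop (𝓝 w) := (continuous_snd.tendsto _).comp hlim
    have hc : ContinuousAt φ s := h.contφ.continuousAt (h.openU.mem_nhds hs)
    refine tendsto_nhds_unique (hc.tendsto.comp h1) (h2.congr fun n => ?_)
    obtain ⟨z, hz, hzp⟩ := hp n
    simp [← hzp]
  have : transfer φ U V X = T ∪ Prod.snd '' (E ∩ Prod.fst ⁻¹' T) := by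
    ext v
    constructor
    · rintro (⟨s, ⟨hs, hsU⟩, rfl⟩ | ⟨s, hs, w, hr, hv⟩)
      · exact Or.inl ⟨(s, φ s), ⟨subset_closure ⟨s, hsU, rfl⟩, hs⟩, rfl⟩
      · exact Or.inr ⟨(w, v), ⟨⟨(h.rel_symm hr).mem_frontier h.openV, hv⟩,
          (s, w), ⟨hr.2, hs⟩, rfl⟩, rfl⟩
    · rintro (⟨⟨s, w⟩, ⟨hw, hs⟩, rfl⟩ | ⟨⟨w, v⟩, ⟨⟨hwV, hvw⟩, ⟨⟨s, w'⟩, ⟨hw, hs⟩, hww⟩⟩, rfl⟩)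
      · by_cases hsU : s ∈ U
        · exact Or.inl ⟨s, ⟨hs, hsU⟩, hcase s w hw hsU⟩
        · have hr : BdryRel φ U s w := ⟨hsU, hw⟩
          exact Or.inr ⟨s, hs, w, hr,
            mem_connectedComponentIn ((h.rel_symm hr).mem_frontier h.openV)⟩
      · obtain rfl : w' = w := hww
        refine Or.inr ⟨s, hs, w', ⟨fun hsU => ?_, hw⟩, hvw⟩
        have := hcase s w' hw hsU
        rw [h.openV.frontier_eq] at hwV
        exact hwV.2 (this ▸ h.mapsφ hsU)
  rw [this]
  exact hTc.isClosed.union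
    ((hEc.inter_right (hTc.isClosed.preimage continuous_fst)).image continuous_snd).isClosed

lemma transfer_union_subset (h : HomeoPair U V R φ ψ) {z₀ w₀ : ℂ} (hr : BdryRel φ U z₀ w₀)
    (γ : Set ℂ) : transfer φ U V (connectedComponentIn (frontier U) z₀ ∪ γ) ⊆
      connectedComponentIn (frontier V) w₀ ∪ transfer φ U V γ := by
  rintro v (⟨s, ⟨hs | hs, hsU⟩, rfl⟩ | ⟨s, hs | hs, w, hrs, hv⟩)
  · have := connectedComponentIn_subset _ _ hs
    rw [h.openU.frontier_eq] at this
    exact absurd hsU this.2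
  · exact Or.inr (Or.inl ⟨s, ⟨hs, hsU⟩, rfl⟩)
  · left
    rwa [connectedComponentIn_eq ((h.mem_component_iff hr hrs).1 hs)]
  · exact Or.inr (Or.inr ⟨s, hs, w, hrs, hv⟩)

lemma transfer_subset_closure (h : HomeoPair U V R φ ψ) (X : Set ℂ) :
    transfer φ U V X ⊆ closure V := by
  rintro v (⟨s, ⟨-, hsU⟩, rfl⟩ | ⟨s, -, w, -, hv⟩)
  · exact subset_closure (h.mapsφ hsU)
  · exact frontier_subset_closure (connectedComponentIn_subset _ _ hv)

theorem exists_dist_le (h : HomeoPair U V R φ ψ) (hUR : closure U ⊆ ball 0 R)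
    (hVR : closure V ⊆ ball 0 R) {z₀ w₀ : ℂ} (hr : BdryRel φ U z₀ w₀)
    (hQ : connectedComponentIn (frontier U) z₀ = {z₀} ∨
      IsJordanCurve (connectedComponentIn (frontier U) z₀))
    (hP : LocallyConnectedSpace (connectedComponentIn (frontier V) w₀))
    (hgood : ∀ η > 0, ∀ r₀ > 0, ∃ r, 0 < r ∧ r < r₀ ∧ ∀ s,
      ∀ p ∈ transfer φ U V (connectedComponentIn
        (sphere z₀ r \ connectedComponentIn (frontier U) z₀) s),
      ∀ q ∈ transfer φ U V (connectedComponentIn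
        (sphere z₀ r \ connectedComponentIn (frontier U) z₀) s), dist p q ≤ η)
    {ρ : ℝ} (hρ : 0 < ρ) :
    ∃ δ > 0, ∀ x ∈ U ∩ ball z₀ δ, ∀ y ∈ U ∩ ball z₀ δ, dist (φ x) (φ y) ≤ 2 * ρ := by
  set Q := connectedComponentIn (frontier U) z₀ with hQdef
  set P := connectedComponentIn (frontier V) w₀ with hPdef
  have hz₀ := hr.mem_frontier h.openU
  have hzQ : z₀ ∈ Q := mem_connectedComponentIn hz₀
  have hQc : IsClosed Q := isClosed_connectedComponentIn isClosed_frontier _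
  have hPc : IsCompact P := h.symm.isCompact_frontier.of_isClosed_subset
    (isClosed_connectedComponentIn isClosed_frontier _) (connectedComponentIn_subset _ _)
  have hfU : Disjoint (frontier U) U := by
    rw [h.openU.frontier_eq]; exact disjoint_sdiff_left
  have hfV : Disjoint (frontier V) V := by
    rw [h.openV.frontier_eq]; exact disjoint_sdiff_left
  have hQU : Disjoint Q U := hfU.mono_left (connectedComponentIn_subset _ _)
  have hPV : Disjoint P V := hfV.mono_left (connectedComponentIn_subset _ _)
  obtain ⟨b, hb⟩ : U.Nonempty := by
    rw [← closure_nonempty_iff]; exact ⟨z₀, hz₀.1⟩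
  obtain ⟨d, hd, hdV⟩ := Metric.nhds_basis_closedBall.mem_iff.1
    (h.openV.mem_nhds (h.mapsφ hb))
  set e := min ρ (d / 2) with he
  have he0 : 0 < e := lt_min hρ (half_pos hd)
  have hed : e ≤ d / 2 := min_le_right _ _
  obtain ⟨η, hη, hlc⟩ := exists_isPreconnected_superset_of_locallyConnectedSpace hPc hP
    (half_pos he0)
  have hη' : 0 < min (η / 2) (e / 2) := lt_min (half_pos hη) (half_pos he0)
  -- choice of the radius
  have hBc : IsCompact (ψ '' closedBall (φ b) d) :=
    (isCompact_closedBall _ _).image_of_continuousOn (h.contψ.mono hdV)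
  have hBU : ψ '' closedBall (φ b) d ⊆ U := by
    rintro _ ⟨w, hw, rfl⟩
    exact h.mapsψ (hdV hw)
  have hbB : b ∈ ψ '' closedBall (φ b) d := ⟨φ b, mem_closedBall_self hd.le, h.left b hb⟩
  have hzB : z₀ ∉ ψ '' closedBall (φ b) d := fun hz => hr.1 (hBU hz)
  obtain ⟨r₀, hr₀, hr₀s⟩ := Metric.nhds_basis_closedBall.mem_iff.1
    (inter_mem (hBc.isClosed.isOpen_compl.mem_nhds hzB)
      (isOpen_ball.mem_nhds (hUR hz₀.1)))
  obtain ⟨r, hr0, hrr, hsmall⟩ := hgood _ hη' r₀ hr₀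
  have hrs : closedBall z₀ r ⊆ (ψ '' closedBall (φ b) d)ᶜ ∩ ball 0 R :=
    (closedBall_subset_closedBall hrr.le).trans hr₀s
  have hbr : b ∉ closedBall z₀ r := fun hbr => (hrs hbr).1 hbB
  -- the crosscut
  obtain ⟨β, hβQ, hβc, hβpre, hzβ, hβr⟩ := exists_isPreconnected_remainder hzQ hQ hr0
  obtain ⟨δ, hδ, hδs⟩ := Metric.nhds_basis_ball.mem_iff.1
    (inter_mem (hβc.isOpen_compl.mem_nhds hzβ) (ball_mem_nhds z₀ hr0))
  obtain ⟨x₀, hx₀δ, hx₀⟩ := mem_closure_iff_nhds.1 hz₀.1 _ (ball_mem_nhds z₀ hδ)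
  obtain ⟨s, hs, hnlog⟩ := exists_connectedComponentIn_sphere_not_hasLog hr0 hQc
    isPreconnected_connectedComponentIn hQU h.openU h.preU hx₀ (hδs hx₀δ).2 hb hbr
  specialize hsmall s
  have hXc := isClosed_union_connectedComponentIn_sphere hQc z₀ r s
  set γ := connectedComponentIn (sphere z₀ r \ Q) s with hγ
  have hγs : γ ⊆ sphere z₀ r := (connectedComponentIn_subset _ _).trans sdiff_subset
  have hunif : ∀ x ∈ U ∩ ball z₀ δ, ¬ HasLog (Q ∪ γ) x b := by
    rintro x ⟨hxU, hxδ⟩ hlog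
    refine hnlog (HasLog.trans ?_ hlog)
    have h1 : HasLog Q x₀ x := HasLog.of_isPreconnected hQc h.preU hQU.symm hx₀ hxU
    have hβball : IsClosed (β ∪ (ball z₀ r)ᶜ) := hβc.union isOpen_ball.isClosed_compl
    have h2 : HasLog (β ∪ (ball z₀ r)ᶜ) x₀ x := by
      refine HasLog.of_isPreconnected hβball (convex_ball z₀ δ).isPreconnected ?_ hx₀δ hxδ
      rw [disjoint_left]
      rintro y hy (hyβ | hyr)
      · exact (hδs hy).1 hyβ
      · exact hyr (hδs hy).2
    have hint : Q ∩ (β ∪ (ball z₀ r)ᶜ) = β := by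
      apply Subset.antisymm
      · rintro y ⟨hyQ, hyβ | hyr⟩
        · exact hyβ
        · exact hβr ⟨hyQ, hyr⟩
      · exact fun y hy => ⟨hβQ hy, Or.inl hy⟩
    refine (HasLog.union hQc hβball (by rwa [hint]) ?_ h1 h2).mono ?_
    · rw [hint]
      exact fun hx => disjoint_left.1 hQU (hβQ hx) hx₀
    · refine union_subset_union_right _ fun y hy => Or.inr fun hyb => ?_
      exact (mem_ball.1 hyb).ne (mem_sphere.1 (hγs hy))
  -- the image crosscut
  set K := transfer φ U V γ with hK
  have hKP : closure K ⊆ P ∪ K := by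
    refine (closure_minimal ?_ (h.isClosed_transfer hXc)).trans (h.transfer_union_subset hr γ)
    rintro v (⟨t, ⟨ht, htU⟩, rfl⟩ | ⟨t, ht, w, hw⟩)
    · exact Or.inl ⟨t, ⟨Or.inr ht, htU⟩, rfl⟩
    · exact Or.inr ⟨t, Or.inr ht, w, hw⟩
  have hKV : closure K ⊆ closure V :=
    closure_minimal (h.transfer_subset_closure γ) isClosed_closure
  have hKsmall : ∀ p ∈ closure K, ∀ q ∈ closure K, dist p q ≤ min (η / 2) (e / 2) := by
    intro p hp q hq
    have hcl : IsClosed {p : ℂ × ℂ | dist p.1 p.2 ≤ min (η / 2) (e / 2)} :=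
      isClosed_le (by fun_prop) continuous_const
    have : closure K ×ˢ closure K ⊆ {p : ℂ × ℂ | dist p.1 p.2 ≤ min (η / 2) (e / 2)} := by
      rw [← closure_prod_eq]
      exact closure_minimal (fun p hp => hsmall _ hp.1 _ hp.2) hcl
    exact this (show (p, q) ∈ _ from ⟨hp, hq⟩)
  obtain ⟨c, hcc, hcpre, hAc, hcP, hAe, hcsmall⟩ := hlc (closure K ∩ P) inter_subset_right
    (fun a ha b hb => (hKsmall a ha.1 b hb.1).trans_lt
      ((min_le_left _ _).trans_lt (half_lt_self hη)))
  set Θ := closure K ∪ c with hΘ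
  have hΘc : IsClosed Θ := isClosed_closure.union hcc
  have hmix : ∀ p ∈ closure K, ∀ q ∈ c, dist p q ≤ e := by
    intro p hp q hq
    have hne : (closure K ∩ P).Nonempty := by
      rw [nonempty_iff_ne_empty]
      intro h0
      rw [hAe h0] at hq
      exact hq
    obtain ⟨a, ha⟩ := hne
    have h1 := (hKsmall p hp a ha.1).trans (min_le_right _ _)
    have h2 := hcsmall a (hAc ha) q hq
    linarith [dist_triangle p a q]
  have hΘsmall : ∀ p ∈ Θ, ∀ q ∈ Θ, dist p q ≤ e := by
    rintro p (hp | hp) q (hq | hq)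
    · linarith [(hKsmall p hp q hq).trans (min_le_right _ _)]
    · exact hmix p hp q hq
    · rw [dist_comm]; exact hmix q hq p hp
    · linarith [hcsmall p hp q hq]
  have hΘb : ∀ p ∈ Θ, e < dist (φ b) p := by
    have hKfar : K ⊆ (ball (φ b) d)ᶜ := by
      rintro v (⟨t, ⟨ht, htU⟩, rfl⟩ | ⟨t, -, w, -, hv⟩) hvb
      · exact (hrs (sphere_subset_closedBall (hγs ht))).1
          ⟨φ t, ball_subset_closedBall hvb, h.left t htU⟩
      · exact disjoint_left.1 hfV (connectedComponentIn_subset _ _ hv)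
          (hdV (ball_subset_closedBall hvb))
    have hcfar : c ⊆ (ball (φ b) d)ᶜ := fun v hv hvb =>
      disjoint_left.1 hPV (hcP hv) (hdV (ball_subset_closedBall hvb))
    intro p hp
    have : p ∈ (ball (φ b) d)ᶜ := by
      rcases hp with hp | hp
      · exact closure_minimal hKfar isOpen_ball.isClosed_compl hp
      · exact hcfar hp
    have := not_lt.1 (fun hh => this (mem_ball'.2 hh))
    linarith
  obtain ⟨w₁, hw₁Θ, hw₁b⟩ : ∃ w₁, Θ ⊆ closedBall w₁ e ∧ φ b ∉ closedBall w₁ e := by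
    rcases Θ.eq_empty_or_nonempty with h0 | ⟨w₁, hw₁⟩
    · refine ⟨φ b + (2 * e : ℝ), by simp [h0], ?_⟩
      rw [mem_closedBall, dist_self_add_right, Complex.norm_real, Real.norm_of_nonneg (by positivity)]
      linarith
    · refine ⟨w₁, fun p hp => hΘsmall p hp w₁ hw₁, fun hcon => ?_⟩
      exact absurd (mem_closedBall.1 hcon) (not_le.2 (hΘb w₁ hw₁))
  -- the main separation argument
  have hclaim : ∀ x ∈ U ∩ ball z₀ δ, φ x ∈ closedBall w₁ e := by
    intro x hx
    by_contra hxw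
    refine hunif x hx ?_
    have hφx := h.mapsφ hx.1
    have hφb := h.mapsφ hb
    have hlog1 : HasLog Θ (φ x) (φ b) :=
      HasLog.of_isPreconnected hΘc (isPreconnected_compl_closedBall w₁ he0)
        (disjoint_left.2 fun y hy hyΘ => hy (hw₁Θ hyΘ)) hxw hw₁b
    have hPRc : IsClosed (P ∪ (ball 0 R)ᶜ) := hPc.isClosed.union isOpen_ball.isClosed_compl
    have hVPR : Disjoint V (P ∪ (ball 0 R)ᶜ) := by
      rw [disjoint_left]
      rintro y hyV (hyP | hyR)
      · exact disjoint_left.1 hPV hyP hyV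
      · exact hyR (h.subV hyV)
    have hlog2 : HasLog (P ∪ (ball 0 R)ᶜ) (φ x) (φ b) :=
      HasLog.of_isPreconnected hPRc h.preV hVPR hφx hφb
    have hint : Θ ∩ (P ∪ (ball 0 R)ᶜ) = c := by
      apply Subset.antisymm
      · rintro y ⟨hyK | hyc, hyP | hyR⟩
        · exact hAc ⟨hyK, hyP⟩
        · exact absurd (hVR (hKV hyK)) hyR
        · exact hyc
        · exact hyc
      · exact fun y hy => ⟨Or.inr hy, Or.inl (hcP hy)⟩
    have hlog := HasLog.union hΘc hPRc (by rwa [hint])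
      (by rw [hint]; exact fun hc => disjoint_left.1 hPV (hcP hc) hφx) hlog1 hlog2
    set Z := Θ ∪ (P ∪ (ball 0 R)ᶜ) with hZ
    have hZc : IsClosed Z := hΘc.union hPRc
    have hxZ : φ x ∈ Zᶜ := by
      rintro (hxΘ | hxP)
      · exact hxw (hw₁Θ hxΘ)
      · exact disjoint_left.1 hVPR hφx hxP
    have hbZ : φ b ∉ Z := by
      rintro (hbΘ | hbP)
      · exact hw₁b (hw₁Θ hbΘ)
      · exact disjoint_left.1 hVPR hφb hbP
    set O := connectedComponentIn Zᶜ (φ x) with hO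
    have hOZ : O ⊆ Zᶜ := connectedComponentIn_subset _ _
    have hOR : O ⊆ ball 0 R := fun y hy => by
      by_contra hyR
      exact hOZ hy (Or.inr (Or.inr hyR))
    have hbO : φ b ∈ O := by
      by_contra hbO
      refine not_hasLog_of_frontier_subset hZc.isOpen_compl.connectedComponentIn
        (isBounded_ball.subset hOR) (mem_connectedComponentIn hxZ) hbO hbZ ?_ hlog
      simpa using frontier_connectedComponentIn_subset_compl hZc.isOpen_compl (φ x)
    have hNpre : IsPreconnected (transfer ψ V U O) :=
      h.symm.isPreconnected_transfer isPreconnected_connectedComponentIn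
        (hOR.trans ball_subset_closedBall)
    refine HasLog.of_isPreconnected hXc hNpre ?_
      (Or.inl ⟨φ x, ⟨mem_connectedComponentIn hxZ, hφx⟩, h.left x hx.1⟩)
      (Or.inl ⟨φ b, ⟨hbO, hφb⟩, h.left b hb⟩)
    rw [disjoint_left]
    rintro y (⟨t, ⟨htO, htV⟩, rfl⟩ | ⟨t, htO, y', hty, hy⟩) hyX
    · have hyU := h.mapsψ htV
      rcases hyX with hyQ | hyγ
      · exact disjoint_left.1 hQU hyQ hyU
      · exact hOZ htO (Or.inl (Or.inl (subset_closure
          (Or.inl ⟨ψ t, ⟨hyγ, hyU⟩, h.right t htV⟩))))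
    · have hty' := h.symm.rel_symm hty
      have htf := hty.mem_frontier h.openV
      rcases hyX with hyQ | hyγ
      · have hy'Q : y' ∈ Q := by
          rw [hQdef, connectedComponentIn_eq hyQ, ← connectedComponentIn_eq hy]
          exact mem_connectedComponentIn (hty'.mem_frontier h.openU)
        exact hOZ htO (Or.inr (Or.inl ((h.mem_component_iff hr hty').1 hy'Q)))
      · obtain ⟨v, hv⟩ := h.exists_rel (connectedComponentIn_subset _ _ hy)
        have hvt := (h.mem_component_iff hty' hv).1 hy
        refine hOZ htO (Or.inl (Or.inl (subset_closure (Or.inr ⟨y, hyγ, v, hv, ?_⟩))))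
        rw [← connectedComponentIn_eq hvt]
        exact mem_connectedComponentIn htf
  refine ⟨δ, hδ, fun x hx y hy => ?_⟩
  have h1 := mem_closedBall.1 (hclaim x hx)
  have h2 := mem_closedBall.1 (hclaim y hy)
  have h3 := dist_triangle_right (φ x) (φ y) w₁
  have h4 : e ≤ ρ := min_le_left _ _
  linarith

end HomeoPair

lemma exists_cover_tsum_ediam_le {X : Type*} [MetricSpace X] [MeasurableSpace X] [BorelSpace X]
    {E : Set X} (hE : μH[1] E < ⊤) {ε : ENNReal} (hε : 0 < ε) :
    ∃ t : ℕ → Set X, E ⊆ ⋃ n, t n ∧ (∀ n, ediam (t n) ≤ ε) ∧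
      ∑' n, ediam (t n) ≤ μH[1] E + 1 := by
  have h1 : (⨅ (t : ℕ → Set X) (_ : E ⊆ ⋃ n, t n) (_ : ∀ n, ediam (t n) ≤ ε),
      ∑' n, ⨆ _ : (t n).Nonempty, ediam (t n) ^ (1 : ℝ)) < μH[1] E + 1 := by
    refine lt_of_le_of_lt ?_ (ENNReal.lt_add_right hE.ne one_ne_zero)
    rw [Measure.hausdorffMeasure_apply]
    exact le_iSup₂_of_le ε hε le_rfl
  simp only [iInf_lt_iff] at h1
  obtain ⟨t, h1, h2, h3⟩ := h1
  refine ⟨t, h1, h2, le_trans (ENNReal.tsum_le_tsum fun n => ?_) h3.le⟩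
  rcases (t n).eq_empty_or_nonempty with h | h
  · simp [h]
  · simp [h]

/-- The Eilenberg inequality in qualitative form. -/
theorem ae_finite_inter_preimage_singleton {X : Type*} [MetricSpace X] [MeasurableSpace X]
    [BorelSpace X] {E : Set X} (hE : μH[1] E < ⊤) {f : X → ℝ} (hf : LipschitzWith 1 f) :
    ∀ᵐ r : ℝ, (E ∩ f ⁻¹' {r}).Finite := by
  have h0 : ∀ k : ℕ, (0 : ENNReal) < ((k : ENNReal))⁻¹ := fun k => by simp
  choose t ht1 ht2 ht3 using fun k => exists_cover_tsum_ediam_le hE (h0 k)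
  set g : ℕ → ℝ → ENNReal := fun k r => ∑' n, (closure (f '' t k n)).indicator 1 r with hg
  have hgm : ∀ k, Measurable (g k) := fun k =>
    Measurable.tsum fun n => measurable_one.indicator isClosed_closure.measurableSet
  have hgi : ∀ k, ∫⁻ r, g k r ≤ μH[1] E + 1 := by
    intro k
    rw [lintegral_tsum fun n =>
      (measurable_one.indicator isClosed_closure.measurableSet).aemeasurable]
    refine le_trans (ENNReal.tsum_le_tsum fun n => ?_) (ht3 k)
    rw [lintegral_indicator_one isClosed_closure.measurableSet]
    refine (Real.volume_le_diam _).trans ?_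
    rw [Metric.ediam_closure]
    simpa using hf.ediam_image_le (t k n)
  have hlim : ∫⁻ r, liminf (fun k => g k r) atTop < ⊤ := by
    refine lt_of_le_of_lt (lintegral_liminf_le hgm) ?_
    refine lt_of_le_of_lt ?_ (ENNReal.add_lt_top.2 ⟨hE, ENNReal.one_lt_top⟩)
    refine liminf_le_of_frequently_le' (Frequently.of_forall hgi)
  filter_upwards [ae_lt_top (Measurable.liminf hgm) hlim.ne] with r hr
  by_contra hinf
  have hinf : (E ∩ f ⁻¹' {r}).Infinite := hinf
  refine hr.ne (ENNReal.eq_top_of_forall_nnreal_le fun m => ?_)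
  obtain ⟨N, hN⟩ := exists_nat_ge m
  refine le_trans (b := (N : ENNReal)) (by exact_mod_cast hN) ?_
  obtain ⟨F, hF, hFc⟩ := hinf.exists_subset_card_eq N
  refine le_liminf_of_le (by isBoundedDefault) ?_
  have hsep : 0 < (F : Set X).einfsep := F.finite_toSet.einfsep_pos
  filter_upwards [ENNReal.tendsto_inv_nat_nhds_zero.eventually (gt_mem_nhds hsep)] with k hk
  have : ∀ x ∈ F, ∃ n, x ∈ t k n := fun x hx => mem_iUnion.1 (ht1 k (hF hx).1)
  choose! i hi using this
  have hinj : InjOn i F := by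
    intro x hx y hy hxy
    by_contra hne
    have h1 := (Set.einfsep_le_edist_of_mem hx hy hne).trans
      (edist_le_ediam_of_mem (hi x hx) (hxy ▸ hi y hy))
    exact absurd (h1.trans (ht2 k _)) (not_le.2 hk)
  calc (N : ENNReal) = ∑ n ∈ F.image i, 1 := by
        rw [Finset.sum_const, Finset.card_image_of_injOn hinj, hFc]; simp
    _ ≤ ∑ n ∈ F.image i, (closure (f '' t k n)).indicator 1 r := by
        refine Finset.sum_le_sum fun n hn => ?_
        obtain ⟨x, hx, rfl⟩ := Finset.mem_image.1 hn
        have hmem : r ∈ closure (f '' t k (i x)) := subset_closure ⟨x, hi x hx, (hF hx).2⟩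
        simp [indicator_of_mem hmem]
    _ ≤ g k r := ENNReal.sum_le_tsum _

lemma SigmaFiniteH1.ae_countable_inter_sphere {E : Set ℂ} (hE : SigmaFiniteH1 E) (z₀ : ℂ) :
    ∀ᵐ r : ℝ, (E ∩ sphere z₀ r).Countable := by
  obtain ⟨f, rfl, hf⟩ := hE
  have h := ae_all_iff.2 fun n =>
    ae_finite_inter_preimage_singleton (hf n) (LipschitzWith.dist_left z₀)
  filter_upwards [h] with r hr
  rw [iUnion_inter]
  exact countable_iUnion fun n => (hr n).countable

/-- The components of `frontier V` corresponding under `φ : U → V` to the points of `τ`. -/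
def bdryComponents (φ : ℂ → ℂ) (U V τ : Set ℂ) : Set (Set ℂ) :=
  {P | ∃ s ∈ τ, ∃ w, BdryRel φ U s w ∧ P = connectedComponentIn (frontier V) w}

lemma bdryComponents_mono {φ : ℂ → ℂ} {U V τ τ' : Set ℂ} (h : τ ⊆ τ') :
    bdryComponents φ U V τ ⊆ bdryComponents φ U V τ' :=
  fun _ ⟨s, hs, w, hw⟩ => ⟨s, h hs, w, hw⟩

/-- The total diameter of the nondegenerate components of `frontier V` corresponding to `τ`. -/
noncomputable def totalDiam (φ : ℂ → ℂ) (U V τ : Set ℂ) : ENNReal :=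
  ∑' P : ↥(NondegComponents (frontier V)),
    (bdryComponents φ U V τ).indicator (fun P => ediam P) (P : Set ℂ)

lemma totalDiam_mono {φ : ℂ → ℂ} {U V τ τ' : Set ℂ} (h : τ ⊆ τ') :
    totalDiam φ U V τ ≤ totalDiam φ U V τ' :=
  ENNReal.tsum_le_tsum fun _ =>
    indicator_le_indicator_of_subset (bdryComponents_mono h) (fun _ => zero_le) _

namespace HomeoPair

variable {U V : Set ℂ} {R : ℝ} {φ ψ : ℂ → ℂ}

lemma eventually_notMem_bdryComponents (h : HomeoPair U V R φ ψ) (z₀ : ℂ) (P : Set ℂ) :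
    ∀ᶠ r in 𝓝[>] (0 : ℝ),
      P ∉ bdryComponents φ U V (sphere z₀ r \ connectedComponentIn (frontier U) z₀) := by
  by_cases hP : ∃ r, P ∈ bdryComponents φ U V (sphere z₀ r \ connectedComponentIn (frontier U) z₀)
  · obtain ⟨r₁, s₁, hs₁, w₁, hr₁, rfl⟩ := hP
    have hz : z₀ ∉ connectedComponentIn (frontier U) s₁ := fun hz => hs₁.2 <| by
      rw [← connectedComponentIn_eq hz]
      exact mem_connectedComponentIn (hr₁.mem_frontier h.openU)
    obtain ⟨ρ, hρ, hball⟩ := Metric.isOpen_iff.1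
      (isClosed_connectedComponentIn isClosed_frontier s₁).isOpen_compl z₀ hz
    filter_upwards [Ioo_mem_nhdsGT hρ] with r hr
    rintro ⟨s, hs, w, hrw, hPw⟩
    have hw : w ∈ connectedComponentIn (frontier V) w₁ := by
      rw [hPw]
      exact mem_connectedComponentIn ((h.rel_symm hrw).mem_frontier h.openV)
    have hs' := (h.mem_component_iff hr₁ hrw).2 hw
    refine hball ?_ hs'
    rw [mem_ball, hs.1]
    exact hr.2
  · push Not at hP
    exact Eventually.of_forall hP

lemma eventually_totalDiam_lt (h : HomeoPair U V R φ ψ) (z₀ : ℂ)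
    (hsum : ∑' P : ↥(NondegComponents (frontier V)), ediam (P : Set ℂ) ≠ ⊤) {ε : ENNReal}
    (hε : 0 < ε) :
    ∀ᶠ r in 𝓝[>] (0 : ℝ),
      totalDiam φ U V (sphere z₀ r \ connectedComponentIn (frontier U) z₀) < ε := by
  obtain ⟨s, hs⟩ := ((ENNReal.tendsto_tsum_compl_atTop_zero hsum).eventually
    (gt_mem_nhds hε)).exists
  have hev := (Finset.eventually_all s).2 fun P _ => h.eventually_notMem_bdryComponents z₀ (P : Set ℂ)
  filter_upwards [hev] with r hr
  refine lt_of_le_of_lt ?_ hs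
  rw [totalDiam, show (∑' b : {x // x ∉ s}, ediam ((b : ↥(NondegComponents (frontier V))) : Set ℂ))
    = _ from tsum_subtype {x | x ∉ s} fun b : ↥(NondegComponents (frontier V)) => ediam (b : Set ℂ)]
  refine ENNReal.tsum_le_tsum fun P => ?_
  by_cases hP : P ∈ s
  · rw [indicator_of_notMem (hr P hP)]
    exact zero_le
  · rw [indicator_of_mem (s := {x | x ∉ s}) hP]
    exact indicator_le_self _ _ _

end HomeoPair

/-- The length, with multiplicity, of the image under `φ` of the part in `U` of the circle of
radius `r` about `z₀`. -/
noncomputable def circleImageLength (φ : ℂ → ℂ) (U : Set ℂ) (z₀ : ℂ) (r : ℝ) : ENNReal :=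
  ∫⁻ θ in Ioo (-Real.pi) Real.pi,
    U.indicator (fun z => ‖deriv φ z‖ₑ) (circleMap z₀ r θ) * ENNReal.ofReal r

lemma image_circleMap_Ioc_neg_pi_pi (z₀ : ℂ) {r : ℝ} (hr : 0 ≤ r) :
    circleMap z₀ r '' Ioc (-Real.pi) Real.pi = sphere z₀ r := by
  have h := (periodic_circleMap z₀ r).image_Ioc Real.two_pi_pos (-Real.pi)
  rw [range_circleMap, abs_of_nonneg hr] at h
  rw [← h]
  congr 2
  ring

lemma volume_image_re_mul_le {φ : ℂ → ℂ} {U : Set ℂ} (hU : IsOpen U) (hφ : DifferentiableOn ℂ φ U)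
    {c : ℂ} (hc : ‖c‖ ≤ 1) (z₀ : ℂ) {r : ℝ} (hr : 0 < r) :
    volume ((fun z => (c * φ z).re) '' (sphere z₀ r ∩ U)) ≤ circleImageLength φ U z₀ r := by
  set A : Set ℝ := Ioc (-Real.pi) Real.pi ∩ circleMap z₀ r ⁻¹' U with hA
  have hAm : MeasurableSet A :=
    measurableSet_Ioc.inter (hU.preimage (continuous_circleMap z₀ r)).measurableSet
  set f' : ℝ → ℝ := fun θ => (c * ((circleMap 0 r θ * Complex.I) • deriv φ (circleMap z₀ r θ))).re
  have hder : ∀ θ ∈ A, HasDerivAt (fun θ => (c * φ (circleMap z₀ r θ)).re) (f' θ) θ := by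
    intro θ hθ
    have h1 : HasDerivAt φ (deriv φ (circleMap z₀ r θ)) (circleMap z₀ r θ) :=
      (hφ.differentiableAt (hU.mem_nhds hθ.2)).hasDerivAt
    have h2 := (h1.scomp θ (hasDerivAt_circleMap z₀ r θ)).const_mul c
    exact Complex.reCLM.hasFDerivAt.comp_hasDerivAt θ h2
  have himg : (fun z => (c * φ z).re) '' (sphere z₀ r ∩ U)
      = (fun θ => (c * φ (circleMap z₀ r θ)).re) '' A := by
    rw [← image_circleMap_Ioc_neg_pi_pi z₀ hr.le, ← image_inter_preimage, image_image]
  rw [himg]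
  refine (addHaar_image_le_lintegral_abs_det_fderiv volume hAm
    fun θ hθ => (hder θ hθ).hasDerivWithinAt.hasFDerivWithinAt).trans ?_
  rw [circleImageLength, setLIntegral_congr (Ioo_ae_eq_Ioc (μ := volume)), hA, inter_comm,
    ← setLIntegral_indicator (hU.preimage (continuous_circleMap z₀ r)).measurableSet]
  refine lintegral_mono fun θ => ?_
  by_cases hθ : circleMap z₀ r θ ∈ U
  · rw [indicator_of_mem (s := circleMap z₀ r ⁻¹' U) hθ, indicator_of_mem hθ,
      ContinuousLinearMap.det_toSpanSingleton]
    have h1 : |f' θ| ≤ ‖deriv φ (circleMap z₀ r θ)‖ * r := by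
      refine (Complex.abs_re_le_norm _).trans ?_
      rw [norm_mul, norm_smul, norm_mul, Complex.norm_I, mul_one, norm_circleMap_zero,
        abs_of_pos hr, mul_comm r]
      exact mul_le_of_le_one_left (by positivity) hc
    refine (ENNReal.ofReal_le_ofReal h1).trans ?_
    rw [ENNReal.ofReal_mul (norm_nonneg _), ofReal_norm]
  · rw [indicator_of_notMem (s := circleMap z₀ r ⁻¹' U) hθ]
    exact zero_le

namespace HomeoPair

variable {U V : Set ℂ} {R : ℝ} {φ ψ : ℂ → ℂ}

lemma countable_setOf_bdryRel_singleton (h : HomeoPair U V R φ ψ)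
    (hN : (NondegComponents (frontier U)).Countable) {γ : Set ℂ}
    (hγ : (SingletonPart (frontier U) ∩ γ).Countable) :
    {w | connectedComponentIn (frontier V) w = {w} ∧ ∃ s ∈ γ, BdryRel φ U s w}.Countable := by
  have : ∀ w ∈ {w | connectedComponentIn (frontier V) w = {w} ∧ ∃ s ∈ γ, BdryRel φ U s w},
    ∃ s ∈ γ, BdryRel φ U s w := fun w hw => hw.2
  choose! s hsγ hs using this
  refine MapsTo.countable_of_injOn (f := fun w => connectedComponentIn (frontier U) (s w))
    (t := NondegComponents (frontier U) ∪ (fun x => {x}) '' (SingletonPart (frontier U) ∩ γ))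
    (fun w hw => ?_) (fun w hw w' hw' hww => ?_) (hN.union (hγ.image _))
  · have hsF := (hs w hw).mem_frontier h.openU
    by_cases hnd : ∃ b ∈ connectedComponentIn (frontier U) (s w), b ≠ s w
    · obtain ⟨b, hb, hne⟩ := hnd
      exact Or.inl ⟨⟨s w, hsF, rfl⟩, b, hb, s w, mem_connectedComponentIn hsF, hne⟩
    · push Not at hnd
      have heq : connectedComponentIn (frontier U) (s w) = {s w} :=
        eq_singleton_iff_unique_mem.2 ⟨mem_connectedComponentIn hsF, hnd⟩
      exact Or.inr ⟨s w, ⟨⟨hsF, heq⟩, hsγ w hw⟩, heq.symm⟩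
  · have h1 : s w' ∈ connectedComponentIn (frontier U) (s w) := by
      have hww : connectedComponentIn (frontier U) (s w) =
        connectedComponentIn (frontier U) (s w') := hww
      rw [hww]
      exact mem_connectedComponentIn ((hs w' hw').mem_frontier h.openU)
    have h2 := (h.mem_component_iff (hs w hw) (hs w' hw')).1 h1
    rw [hw.1] at h2
    exact h2.symm

lemma volume_image_re_mul_transfer_le (h : HomeoPair U V R φ ψ) (hφ : DifferentiableOn ℂ φ U)
    (hNU : (NondegComponents (frontier U)).Countable)
    (hNV : (NondegComponents (frontier V)).Countable) {z₀ : ℂ} {r : ℝ} (hr : 0 < r)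
    {γ : Set ℂ} (hγ : γ ⊆ sphere z₀ r) (hγc : (SingletonPart (frontier U) ∩ γ).Countable)
    {c : ℂ} (hc : ‖c‖ ≤ 1) :
    volume ((fun w => (c * w).re) '' transfer φ U V γ) ≤
      circleImageLength φ U z₀ r + totalDiam φ U V γ := by
  set u : ℂ → ℝ := fun w => (c * w).re with hu
  have hlip : LipschitzWith 1 u := by
    refine LipschitzWith.of_dist_le_mul fun a b => ?_
    rw [NNReal.coe_one, one_mul, Real.dist_eq, dist_eq_norm]
    calc |u a - u b| = |(c * (a - b)).re| := by rw [hu, mul_sub, Complex.sub_re]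
      _ ≤ ‖c * (a - b)‖ := Complex.abs_re_le_norm _
      _ ≤ ‖a - b‖ := by
        rw [norm_mul]
        exact mul_le_of_le_one_left (norm_nonneg _) hc
  set S := {w | connectedComponentIn (frontier V) w = {w} ∧ ∃ s ∈ γ, BdryRel φ U s w} with hS
  set T : ↥(NondegComponents (frontier V)) → Set ℝ :=
    fun P => {y | (P : Set ℂ) ∈ bdryComponents φ U V γ ∧ y ∈ u '' (P : Set ℂ)} with hT
  have hsub : u '' transfer φ U V γ ⊆
      (fun z => u (φ z)) '' (sphere z₀ r ∩ U) ∪ (⋃ P, T P) ∪ u '' S := by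
    rintro _ ⟨p, hp, rfl⟩
    rcases hp with ⟨s, hs, rfl⟩ | ⟨s, hs, w, hrw, hpw⟩
    · exact Or.inl (Or.inl ⟨s, ⟨hγ hs.1, hs.2⟩, rfl⟩)
    · have hwF := (h.rel_symm hrw).mem_frontier h.openV
      by_cases hnd : ∃ b ∈ connectedComponentIn (frontier V) w, b ≠ w
      · obtain ⟨b, hb, hne⟩ := hnd
        refine Or.inl (Or.inr (mem_iUnion.2 ⟨⟨connectedComponentIn (frontier V) w,
          ⟨w, hwF, rfl⟩, b, hb, w, mem_connectedComponentIn hwF, hne⟩, ?_⟩))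
        exact ⟨⟨s, hs, w, hrw, rfl⟩, p, hpw, rfl⟩
      · push Not at hnd
        obtain rfl := hnd p hpw
        exact Or.inr ⟨p, ⟨eq_singleton_iff_unique_mem.2 ⟨hpw, hnd⟩, s, hs, hrw⟩, rfl⟩
  have : Countable ↥(NondegComponents (frontier V)) := hNV.to_subtype
  have hS0 : volume (u '' S) = 0 :=
    ((h.countable_setOf_bdryRel_singleton hNU hγc).image u).measure_zero _
  calc volume (u '' transfer φ U V γ)
      ≤ volume ((fun z => u (φ z)) '' (sphere z₀ r ∩ U)) + volume (⋃ P, T P) + volume (u '' S) :=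
        (measure_mono hsub).trans ((measure_union_le _ _).trans (by gcongr; exact measure_union_le _ _))
    _ ≤ circleImageLength φ U z₀ r + totalDiam φ U V γ := by
        rw [hS0, add_zero]
        gcongr
        · exact volume_image_re_mul_le h.openU hφ hc z₀ hr
        · refine (measure_iUnion_le _).trans (ENNReal.tsum_le_tsum fun P => ?_)
          by_cases hP : (P : Set ℂ) ∈ bdryComponents φ U V γ
          · rw [indicator_of_mem hP]
            refine (measure_mono fun y hy => hy.2).trans ((Real.volume_le_diam _).trans ?_)
            simpa using hlip.ediam_image_le (P : Set ℂ)
          · simp [hT, hP]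

theorem edist_le_of_mem_transfer (h : HomeoPair U V R φ ψ) (hφ : DifferentiableOn ℂ φ U)
    (hNU : (NondegComponents (frontier U)).Countable)
    (hNV : (NondegComponents (frontier V)).Countable) {z₀ : ℂ} {r : ℝ} (hr : 0 < r)
    {γ : Set ℂ} (hγ : γ ⊆ sphere z₀ r) (hγc : (SingletonPart (frontier U) ∩ γ).Countable)
    (hγp : IsPreconnected γ) (hγR : γ ⊆ closedBall 0 R) {p q : ℂ} (hp : p ∈ transfer φ U V γ)
    (hq : q ∈ transfer φ U V γ) :
    edist p q ≤ circleImageLength φ U z₀ r + totalDiam φ U V γ := by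
  rcases eq_or_ne p q with rfl | hne
  · simp
  have hn : ‖p - q‖ ≠ 0 := norm_ne_zero_iff.2 (sub_ne_zero.2 hne)
  set c : ℂ := starRingEnd ℂ (p - q) / ‖p - q‖ with hc
  have hc1 : ‖c‖ ≤ 1 := by
    rw [hc, norm_div, Complex.norm_real, norm_norm, Complex.norm_conj, div_self hn]
  refine le_trans ?_ (h.volume_image_re_mul_transfer_le hφ hNU hNV hr hγ hγc hc1)
  have hpre : IsPreconnected ((fun w => (c * w).re) '' transfer φ U V γ) :=
    (h.isPreconnected_transfer hγp hγR).image _ (by fun_prop)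
  have hsub := hpre.Icc_subset (mem_image_of_mem _ hq) (mem_image_of_mem _ hp)
  refine le_trans ?_ (measure_mono hsub)
  rw [Real.volume_Icc, ← Complex.sub_re, ← mul_sub]
  have : c * (p - q) = (‖p - q‖ : ℂ) := by
    rw [hc, div_mul_eq_mul_div, mul_comm, Complex.mul_conj, Complex.normSq_eq_norm_sq]
    have : (‖p - q‖ : ℂ) ≠ 0 := by exact_mod_cast hn
    push_cast
    field_simp
  rw [this, Complex.ofReal_re, edist_dist, dist_eq_norm]

end HomeoPair

lemma lintegral_enorm_deriv_sq_eq_volume_image {φ : ℂ → ℂ} {U : Set ℂ} (hU : IsOpen U)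
    (hφ : DifferentiableOn ℂ φ U) (hinj : InjOn φ U) :
    ∫⁻ z in U, ‖deriv φ z‖ₑ ^ 2 = volume (φ '' U) := by
  have hd : ∀ z ∈ U, HasFDerivWithinAt φ
      ((ContinuousLinearMap.toSpanSingleton ℂ (deriv φ z)).restrictScalars ℝ) U z := fun z hz =>
    ((hφ.differentiableAt (hU.mem_nhds hz)).hasDerivAt.hasFDerivAt.restrictScalars ℝ
      ).hasFDerivWithinAt
  rw [← lintegral_abs_det_fderiv_eq_addHaar_image volume hU.measurableSet hd hinj]
  refine setLIntegral_congr_fun hU.measurableSet fun z _ => ?_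
  have : ((ContinuousLinearMap.toSpanSingleton ℂ (deriv φ z)).restrictScalars ℝ).det =
      ‖deriv φ z‖ ^ 2 := by
    simp [ContinuousLinearMap.det, LinearMap.det_restrictScalars, Algebra.norm_complex_eq,
      Complex.normSq_eq_norm_sq]
  simp only [this]
  rw [abs_of_nonneg (by positivity), ENNReal.ofReal_pow (norm_nonneg _), ofReal_norm]

lemma lintegral_circleMap_eq {G : ℂ → ENNReal} (hG : Measurable G) (z₀ : ℂ) :
    ∫⁻ r in Ioi (0 : ℝ), ∫⁻ θ in Ioo (-Real.pi) Real.pi,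
      ENNReal.ofReal r * G (circleMap z₀ r θ) = ∫⁻ z, G z := by
  rw [← lintegral_add_left_eq_self G z₀, ← Complex.lintegral_comp_polarCoord_symm,
    polarCoord_target, Measure.volume_eq_prod, ← Measure.prod_restrict, lintegral_prod]
  · refine lintegral_congr fun r => lintegral_congr fun θ => ?_
    simp only [Complex.polarCoord_symm_apply, circleMap, Complex.exp_mul_I, smul_eq_mul,
      Complex.ofReal_cos, Complex.ofReal_sin]
  · refine Measurable.aemeasurable ?_
    simp only [Complex.polarCoord_symm_apply, smul_eq_mul]
    fun_prop

lemma circleImageLength_sq_le (φ : ℂ → ℂ) {U : Set ℂ} (hU : IsOpen U) (z₀ : ℂ) (r : ℝ) :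
    circleImageLength φ U z₀ r ^ 2 ≤ ENNReal.ofReal (2 * Real.pi) * (ENNReal.ofReal r *
      ∫⁻ θ in Ioo (-Real.pi) Real.pi,
        ENNReal.ofReal r * U.indicator (fun z => ‖deriv φ z‖ₑ ^ 2) (circleMap z₀ r θ)) := by
  set f : ℝ → ENNReal :=
    fun θ => U.indicator (fun z => ‖deriv φ z‖ₑ) (circleMap z₀ r θ) * ENNReal.ofReal r with hf
  have hfm : Measurable f :=
    ((((measurable_deriv φ).enorm.indicator hU.measurableSet).comp
      (continuous_circleMap z₀ r).measurable).mul_const _)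
  have hCS := ENNReal.lintegral_mul_le_Lp_mul_Lq (volume.restrict (Ioo (-Real.pi) Real.pi))
    Real.HolderConjugate.two_two hfm.aemeasurable (aemeasurable_const (b := (1 : ENNReal)))
  have h2 : ∫⁻ θ in Ioo (-Real.pi) Real.pi, f θ ^ (2 : ℝ) = ENNReal.ofReal r *
      ∫⁻ θ in Ioo (-Real.pi) Real.pi,
        ENNReal.ofReal r * U.indicator (fun z => ‖deriv φ z‖ₑ ^ 2) (circleMap z₀ r θ) := by
    rw [← lintegral_const_mul' _ _ ENNReal.ofReal_ne_top]
    refine lintegral_congr fun θ => ?_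
    by_cases hθ : circleMap z₀ r θ ∈ U
    · simp only [hf, indicator_of_mem hθ, ENNReal.rpow_two]
      ring
    · simp [hf, indicator_of_notMem hθ]
  have hL : circleImageLength φ U z₀ r ≤ (∫⁻ θ in Ioo (-Real.pi) Real.pi, f θ ^ (2 : ℝ)) ^
      (1 / 2 : ℝ) * (ENNReal.ofReal (2 * Real.pi)) ^ (1 / 2 : ℝ) := by
    have hpi : Real.pi + Real.pi = 2 * Real.pi := by ring
    simpa [circleImageLength, hf, hpi] using hCS
  refine (pow_le_pow_left' hL 2).trans_eq ?_
  rw [mul_pow, ← ENNReal.rpow_two, ← ENNReal.rpow_two, ← ENNReal.rpow_mul, ← ENNReal.rpow_mul, h2,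
    mul_comm]
  norm_num

lemma lintegral_Ioo_inv_eq_top {ρ : ℝ} (hρ : 0 < ρ) :
    ∫⁻ r in Ioo 0 ρ, ENNReal.ofReal r⁻¹ = ⊤ := by
  by_contra hne
  have hm : AEStronglyMeasurable (fun r : ℝ => r⁻¹) (volume.restrict (Ioo 0 ρ)) :=
    measurable_inv.aestronglyMeasurable
  have hpos : 0 ≤ᵐ[volume.restrict (Ioo 0 ρ)] fun r : ℝ => r⁻¹ := by
    filter_upwards [ae_restrict_mem measurableSet_Ioo] with r hr
    exact inv_nonneg.2 hr.1.le
  have hint : IntegrableOn (fun r : ℝ => r ^ (-1 : ℝ)) (Ioo 0 ρ) := by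
    simp only [Real.rpow_neg_one]
    exact (lintegral_ofReal_ne_top_iff_integrable hm hpos).1 hne
  rw [intervalIntegral.integrableOn_Ioo_rpow_iff hρ] at hint
  exact lt_irrefl _ hint

/-- The length-area argument: there are arbitrarily small circles with short image, and they can be
chosen outside any prescribed null set of radii. -/
theorem exists_circleImageLength_lt {φ : ℂ → ℂ} {U : Set ℂ} (hU : IsOpen U)
    (hφ : DifferentiableOn ℂ φ U) (hinj : InjOn φ U) (hvol : volume (φ '' U) ≠ ⊤) (z₀ : ℂ)
    {p : ℝ → Prop} (hp : ∀ᵐ r, p r) {η : ENNReal} (hη : 0 < η) {ρ : ℝ} (hρ : 0 < ρ) :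
    ∃ r ∈ Ioo 0 ρ, p r ∧ circleImageLength φ U z₀ r < η := by
  by_contra! hcon
  set H : ℝ → ENNReal := fun r => ∫⁻ θ in Ioo (-Real.pi) Real.pi,
        ENNReal.ofReal r * U.indicator (fun z => ‖deriv φ z‖ₑ ^ 2) (circleMap z₀ r θ) with hH
  have hHfin : ∫⁻ r in Ioi (0 : ℝ), H r ≠ ⊤ := by
    rw [hH, lintegral_circleMap_eq
      (((measurable_deriv φ).enorm.pow_const 2).indicator hU.measurableSet) z₀,
      lintegral_indicator hU.measurableSet, lintegral_enorm_deriv_sq_eq_volume_image hU hφ hinj]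
    exact hvol
  have hle : ∀ᵐ r ∂(volume.restrict (Ioo 0 ρ)),
      η ^ 2 * ENNReal.ofReal r⁻¹ ≤ ENNReal.ofReal (2 * Real.pi) * H r := by
    filter_upwards [ae_restrict_mem measurableSet_Ioo, ae_restrict_of_ae hp] with r hr hpr
    have h1 := (pow_le_pow_left' (hcon r hr hpr) 2).trans (circleImageLength_sq_le φ hU z₀ r)
    calc η ^ 2 * ENNReal.ofReal r⁻¹
        ≤ ENNReal.ofReal (2 * Real.pi) * (ENNReal.ofReal r * H r) * ENNReal.ofReal r⁻¹ := by
          gcongr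
      _ = ENNReal.ofReal (2 * Real.pi) * H r * (ENNReal.ofReal r * ENNReal.ofReal r⁻¹) := by ring
      _ = ENNReal.ofReal (2 * Real.pi) * H r := by
          rw [← ENNReal.ofReal_mul hr.1.le, mul_inv_cancel₀ hr.1.ne', ENNReal.ofReal_one, mul_one]
  have hint := lintegral_mono_ae hle
  rw [lintegral_const_mul' _ _ ENNReal.ofReal_ne_top, lintegral_const_mul _ (by fun_prop),
    lintegral_Ioo_inv_eq_top hρ, ENNReal.mul_top (pow_ne_zero 2 hη.ne'), top_le_iff] at hint
  have h2 : ∫⁻ r in Ioo 0 ρ, H r ≠ ⊤ :=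
    ne_top_of_le_ne_top hHfin (lintegral_mono_set Ioo_subset_Ioi_self)
  exact ENNReal.mul_ne_top ENNReal.ofReal_ne_top h2 hint

lemma HomeoPair.mono {U V : Set ℂ} {R R' : ℝ} {φ ψ : ℂ → ℂ} (h : HomeoPair U V R φ ψ)
    (hR : R ≤ R') : HomeoPair U V R' φ ψ :=
  { h with subU := h.subU.trans (ball_subset_ball hR), subV := h.subV.trans (ball_subset_ball hR) }

lemma IsPeanoCompactum.countable_nondegComponents {K : Set ℂ} (hK : IsPeanoCompactum K) :
    (NondegComponents K).Countable := by
  have hc : (⋃ n : ℕ, {Q : Set ℂ | (∃ x ∈ K, Q = connectedComponentIn K x) ∧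
      1 / ((n : ℝ) + 1) < Metric.diam Q}).Countable :=
    countable_iUnion fun n => (hK.2.2 _ Nat.one_div_pos_of_nat).countable
  refine hc.mono ?_
  rintro Q ⟨⟨x, hx, rfl⟩, a, ha, b, hb, hab⟩
  have hd : 0 < Metric.diam (connectedComponentIn K x) :=
    (dist_pos.2 hab).trans_le (dist_le_diam_of_mem
      (hK.1.isBounded.subset (connectedComponentIn_subset _ _)) ha hb)
  obtain ⟨n, hn⟩ := exists_nat_one_div_lt hd
  exact mem_iUnion.2 ⟨n, ⟨x, hx, rfl⟩, hn⟩

lemma exists_extendsContinuously {φ : ℂ → ℂ} {U V : Set ℂ} (hU : IsOpen U)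
    (hφ : ContinuousOn φ U) (hm : MapsTo φ U V)
    (hosc : ∀ z₀ ∈ frontier U, ∀ ε > 0, ∃ δ > 0, ∀ x ∈ U ∩ ball z₀ δ, ∀ y ∈ U ∩ ball z₀ δ,
      dist (φ x) (φ y) < ε) :
    ∃ φb, ExtendsContinuously φ φb U V := by
  have hlim : ∀ z ∈ closure U, ∃ y, Tendsto φ (𝓝[U] z) (𝓝 y) := by
    intro z hz
    by_cases hzU : z ∈ U
    · exact ⟨φ z, hφ z hzU⟩
    · have : (𝓝[U] z).NeBot := mem_closure_iff_nhdsWithin_neBot.1 hz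
      refine cauchy_map_iff_exists_tendsto.1 (Metric.cauchy_iff.2 ⟨inferInstance, fun ε hε => ?_⟩)
      obtain ⟨δ, hδ, hd⟩ := hosc z (hU.frontier_eq ▸ ⟨hz, hzU⟩) ε hε
      refine ⟨φ '' (U ∩ ball z δ), image_mem_map
        (inter_mem self_mem_nhdsWithin (mem_nhdsWithin_of_mem_nhds (ball_mem_nhds z hδ))), ?_⟩
      rintro _ ⟨x, hx, rfl⟩ _ ⟨y, hy, rfl⟩
      exact hd x hx y hy
  refine ⟨extendFrom U φ, continuousOn_extendFrom subset_rfl hlim,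
    extendFrom_extends hφ, fun z hz => ?_⟩
  have : (𝓝[U] z).NeBot := mem_closure_iff_nhdsWithin_neBot.1 hz
  exact mem_closure_of_tendsto (tendsto_extendFrom (hlim z hz))
    (eventually_nhdsWithin_of_forall fun x hx => hm hx)

theorem exists_extends_of_isPeanoCompactum {D Ω : Set ℂ} {φ : ℂ → ℂ}
    (hD : IsGeneralizedJordanDomain D) (hsing : SigmaFiniteH1 (SingletonPart (frontier D)))
    (hΩ : IsPlanarDomain Ω) (hΩb : Bornology.IsBounded Ω)
    (hcount : (NondegComponents (frontier Ω)).Countable)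
    (hdiam : ∑' Q : ↥(NondegComponents (frontier Ω)), ediam (Q : Set ℂ) < ⊤)
    (hφ : IsConformalHomeoOnto φ D Ω) (hP : IsPeanoCompactum (frontier Ω)) :
    ∃ φb, ExtendsContinuously φ φb D Ω := by
  obtain ⟨R₀, ψ, hR₀, h₀⟩ := hφ.exists_homeoPair hD.1 hΩ hD.2.1 hΩb
  have hcl : ∀ W ⊆ ball (0 : ℂ) R₀, closure W ⊆ ball 0 (R₀ + 1) := fun W hW =>
    (closure_mono hW).trans (closure_ball_subset_closedBall.trans
      (closedBall_subset_ball (lt_add_one _)))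
  have hDR := hcl D h₀.subU
  have hΩR := hcl Ω h₀.subV
  have h := h₀.mono (lt_add_one R₀).le
  set R := R₀ + 1
  have hvol : volume (φ '' D) ≠ ⊤ :=
    ((hΩb.subset h.mapsφ.image_subset).measure_lt_top (μ := volume)).ne
  refine exists_extendsContinuously h.openU h.contφ h.mapsφ fun z₀ hz₀ ε hε => ?_
  obtain ⟨w₀, hr⟩ := h.exists_rel hz₀
  have hz₀R : 0 < R - ‖z₀‖ := by
    have := hDR hz₀.1
    rw [mem_ball_zero_iff] at this
    linarith
  have hgood : ∀ η > 0, ∀ r₀ > 0, ∃ r, 0 < r ∧ r < r₀ ∧ ∀ s,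
      ∀ p ∈ transfer φ D Ω (connectedComponentIn (sphere z₀ r \ connectedComponentIn (frontier D) z₀) s),
      ∀ q ∈ transfer φ D Ω (connectedComponentIn (sphere z₀ r \ connectedComponentIn (frontier D) z₀) s),
        dist p q ≤ η := by
    intro η hη r₀ hr₀
    have hη2 : 0 < ENNReal.ofReal (η / 2) := ENNReal.ofReal_pos.2 (by positivity)
    obtain ⟨ρ, hρ, htail⟩ := mem_nhdsGT_iff_exists_Ioo_subset.1
      (h.eventually_totalDiam_lt z₀ hdiam.ne hη2)
    obtain ⟨r, hrI, hrc, hrL⟩ := exists_circleImageLength_lt h.openU hφ.1 hφ.2.injOn hvol z₀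
      (hsing.ae_countable_inter_sphere z₀) hη2
      (lt_min (lt_min hr₀ hρ) hz₀R : 0 < min (min r₀ ρ) (R - ‖z₀‖))
    have hr1 := hrI.2.trans_le ((min_le_left _ _).trans (min_le_left _ _))
    have hr2 := hrI.2.trans_le ((min_le_left _ _).trans (min_le_right _ _))
    have hr3 := hrI.2.trans_le (min_le_right _ _)
    refine ⟨r, hrI.1, hr1, fun s p hp q hq => ?_⟩
    set Q := connectedComponentIn (frontier D) z₀
    have hγ : connectedComponentIn (sphere z₀ r \ Q) s ⊆ sphere z₀ r \ Q :=
      connectedComponentIn_subset _ _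
    have hγs := hγ.trans sdiff_subset
    have hγR : connectedComponentIn (sphere z₀ r \ Q) s ⊆ closedBall 0 R := by
      refine hγs.trans (sphere_subset_closedBall.trans (closedBall_subset_closedBall' ?_))
      rw [dist_zero_right]
      linarith
    have hle := h.edist_le_of_mem_transfer hφ.1 hD.2.2.1.countable_nondegComponents hcount hrI.1 hγs
      (hrc.mono (inter_subset_inter_right _ hγs)) isPreconnected_connectedComponentIn hγR hp hq
    have hle2 : edist p q ≤ ENNReal.ofReal (η / 2) + ENNReal.ofReal (η / 2) :=
      hle.trans (add_le_add hrL.le ((totalDiam_mono hγ).trans (htail ⟨hrI.1, hr2⟩).le))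
    rw [← ENNReal.ofReal_add (by positivity) (by positivity), add_halves] at hle2
    exact (edist_le_ofReal hη.le).1 hle2
  obtain ⟨δ, hδ, hd⟩ := h.exists_dist_le hDR hΩR hr (hD.2.2.2 z₀ hz₀)
    (hP.2.1 w₀ ((h.rel_symm hr).mem_frontier h.openV)) hgood (ρ := ε / 4) (by positivity)
  exact ⟨δ, hδ, fun x hx y hy => (hd x hx y hy).trans_lt (by linarith)⟩

/-- Second generalization of the continuity theorem, for generalized Jordan domains. -/
theorem stmt_19 (Ω₁ Ω₂ : Set ℂ) (φ : ℂ → ℂ)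
    (hΩ₁ : IsGeneralizedJordanDomain Ω₁)
    (hsing : SigmaFiniteH1 (SingletonPart (frontier Ω₁)))
    (hΩ₂ : IsPlanarDomain Ω₂) (hΩ₂b : Bornology.IsBounded Ω₂)
    (hcount : (NondegComponents (frontier Ω₂)).Countable)
    (hdiam : ∑' Q : ↥(NondegComponents (frontier Ω₂)), EMetric.diam (Q : Set ℂ) < ⊤)
    (hφ : IsConformalHomeoOnto φ Ω₁ Ω₂) :
    (∃ φb : ℂ → ℂ, ExtendsContinuously φ φb Ω₁ Ω₂) ↔
      IsPeanoCompactum (frontier Ω₂) := by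
  exact ⟨fun ⟨_, hext⟩ => isPeanoCompactum_of_extends hΩ₁.2.1 hΩ₁.1 hΩ₁.2.2.1 hΩ₂ hΩ₂b hdiam hφ hext,
    exists_extends_of_isPeanoCompactum hΩ₁ hsing hΩ₂ hΩ₂b hcount hdiam hφ⟩
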